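/- arXiv:2011.04809 — 2 statements merged into one kernel-verified Lean document; each statement's English description precedes it below -/
import Mathlib

section
/- Let d ≥ 2 be an integer and let f be a real-valued, strictly positive, real-analytic function on the simplex Z = {(ζ₁,…,ζ_{d−1}) : ζ_i ≥ 0 for all i and Σ ζ_i ≤ 1}. For each n let S_n = Σ_{z₁+⋯+z_d = n} (n!/(z₁!⋯z_d!)) · f(z₁/n,…,z_{d−1}/n)^n, the sum over all d-tuples of non-negative integers summing to n. Define g on Z by g(ζ₁,…,ζ_{d−1}) = f(ζ₁,…,ζ_{d−1}) / (ζ₁^{ζ₁} ⋯ ζ_{d−1}^{ζ_{d−1}} (1−ζ₁−⋯−ζ_{d−1})^{1−ζ₁−⋯−ζ_{d−1}}), with the convention 0^0 = 1. If (i) there exists ζ_max in the interior of Z such that g(ζ_max) = g_max > g(ζ) for all ζ ∈ Z with ζ ≠ ζ_max, and (ii) the determinant of the (d−1)×(d−1) matrix of second partial derivatives of g at ζ_max is nonzero, then there exists a constant D such that for all sufficiently large n, S_n < D · g_max^n. -/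
open Filter Real

/-- The second partial derivative of `g` at `x` in the coordinate directions `i`, `j`. -/
noncomputable def hessEntry {e : ℕ} (g : (Fin e → ℝ) → ℝ) (x : Fin e → ℝ)
    (i j : Fin e) : ℝ :=
  fderiv ℝ (fun y => fderiv ℝ g y (Pi.single j 1)) x (Pi.single i 1)

lemma taylor_aux {e : ℕ} (g : (Fin e → ℝ) → ℝ) (x : Fin e → ℝ) (hg : ContDiffAt ℝ 2 g x)
    (h0 : fderiv ℝ g x = 0) (ε : ℝ) (hε : 0 < ε) :
    ∀ᶠ y in nhds x,
      |g y - g x - 1 / 2 * fderiv ℝ (fderiv ℝ g) x (y - x) (y - x)| ≤ ε * ‖y - x‖ ^ 2 := by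
  have hsymm : IsSymmSndFDerivAt ℝ g x := hg.isSymmSndFDerivAt (by simp)
  have hd2 : DifferentiableAt ℝ (fderiv ℝ g) x :=
    (hg.fderiv_right (m := 1) (by norm_num)).differentiableAt (by norm_num)
  set B := fderiv ℝ (fderiv ℝ g) x with hB
  have hlo := (hd2.hasFDerivAt.isLittleO).def hε
  have hdiff : ∀ᶠ y in nhds x, DifferentiableAt ℝ g y := by
    filter_upwards [hg.eventually (by simp)] with y hy
    exact hy.differentiableAt (by norm_num)
  obtain ⟨r, hr, hball⟩ := Metric.eventually_nhds_iff_ball.1 (hlo.and hdiff)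
  filter_upwards [Metric.ball_mem_nhds x hr] with y hy
  have hyr : ‖y - x‖ < r := by simpa [dist_eq_norm] using hy
  have key := Convex.norm_image_sub_le_of_norm_hasFDerivWithin_le (𝕜 := ℝ)
    (f := fun z => g z - 1 / 2 * B (z - x) (z - x))
    (f' := fun z => fderiv ℝ g z - B (z - x)) (s := Metric.closedBall x ‖y - x‖)
    (C := ε * ‖y - x‖) (x := x) (y := y) ?_ ?_ (convex_closedBall _ _) (by simp)
    (by simp [dist_eq_norm])
  · simp only [sub_self, map_zero, mul_zero, sub_zero, Real.norm_eq_abs] at key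
    calc _ = |g y - 1 / 2 * B (y - x) (y - x) - g x| := by congr 1; ring
      _ ≤ _ := key
      _ = _ := by ring
  · intro z hz
    have hz' : ‖z - x‖ ≤ ‖y - x‖ := by simpa [dist_eq_norm] using hz
    have hzb := (hball z (by simp [dist_eq_norm]; linarith)).2
    have h1 : HasFDerivAt (fun z : Fin e → ℝ => z - x) (ContinuousLinearMap.id ℝ _) z :=
      (hasFDerivAt_id z).sub_const x
    have h2 : HasFDerivAt (fun z => B (z - x)) B z := by
      exact (B.hasFDerivAt.comp z h1).congr_fderiv (by ext; simp)
    have h3 := h2.clm_apply h1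
    have h4 := hzb.hasFDerivAt.sub (h3.const_mul (1 / 2))
    refine (h4.congr_fderiv ?_).hasFDerivWithinAt
    ext v
    have := hsymm v (z - x)
    simp only [← hB] at this
    simp only [map_sub, sub_apply] at this
    simp
    linarith
  · intro z hz
    have hz' : ‖z - x‖ ≤ ‖y - x‖ := by simpa [dist_eq_norm] using hz
    have hzb := (hball z (by simp [dist_eq_norm]; linarith)).1
    rw [h0, sub_zero] at hzb
    exact hzb.trans (by gcongr)

lemma quad_max {e : ℕ} (g : (Fin e → ℝ) → ℝ) (x : Fin e → ℝ) (hg : ContDiffAt ℝ 2 g x)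
    (hmax : IsLocalMax g x)
    (hdet : Matrix.det (Matrix.of fun i j => hessEntry g x i j) ≠ 0) :
    ∃ c > 0, ∀ᶠ y in nhds x, g y ≤ g x - c * ‖y - x‖ ^ 2 := by
  have h0 : fderiv ℝ g x = 0 := hmax.fderiv_eq_zero
  have htay := taylor_aux g x hg h0
  have hsymm : IsSymmSndFDerivAt ℝ g x := hg.isSymmSndFDerivAt (by simp)
  have hd2 : DifferentiableAt ℝ (fderiv ℝ g) x :=
    (hg.fderiv_right (m := 1) (by norm_num)).differentiableAt (by norm_num)
  have hentry : ∀ i j, hessEntry g x i j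
      = fderiv ℝ (fderiv ℝ g) x (Pi.single i 1) (Pi.single j 1) := by
    intro i j
    unfold hessEntry
    rw [fderiv_clm_apply hd2 (by fun_prop)]
    simp
  unfold IsSymmSndFDerivAt at hsymm
  set B := fderiv ℝ (fderiv ℝ g) x with hB
  -- negative semidefinite
  have hneg : ∀ v, B v v ≤ 0 := by
    intro v
    refine le_of_forall_pos_le_add fun ε hε => ?_
    set δ := ε / (2 * (‖v‖ ^ 2 + 1)) with hδ
    have hδ0 : 0 < δ := by positivity
    have hev := (htay δ hδ0).and hmax
    have hcont : Tendsto (fun t : ℝ => x + t • v) (nhds 0) (nhds x) := by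
      have : Continuous (fun t : ℝ => x + t • v) := by fun_prop
      simpa using this.tendsto 0
    have hev2 := hcont.eventually hev
    have hev3 : ∀ᶠ t : ℝ in nhdsWithin 0 (Set.Ioi 0), _ := hev2.filter_mono nhdsWithin_le_nhds
    obtain ⟨t, ⟨ht1, ht2⟩, ht0⟩ := (hev3.and self_mem_nhdsWithin).exists
    have ht0 : 0 < t := ht0
    simp only [add_sub_cancel_left, map_smul, norm_smul, smul_apply,
      smul_eq_mul, Real.norm_eq_abs, abs_of_pos ht0] at ht1
    have h5 := (abs_le.1 ht1).1
    have h6 : t ^ 2 * (B v v) ≤ t ^ 2 * (2 * δ * ‖v‖ ^ 2) := by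
      nlinarith
    have h7 := le_of_mul_le_mul_left h6 (by positivity)
    have h8 : 2 * δ * ‖v‖ ^ 2 ≤ ε := by
      rw [hδ]
      have : 2 * (ε / (2 * (‖v‖ ^ 2 + 1))) * ‖v‖ ^ 2 = ε * (‖v‖ ^ 2 / (‖v‖ ^ 2 + 1)) := by
        field_simp
      rw [this]
      have : ‖v‖ ^ 2 / (‖v‖ ^ 2 + 1) ≤ 1 := by
        rw [div_le_one (by positivity)]; linarith
      nlinarith
    linarith
  -- matrix
  set M : Matrix (Fin e) (Fin e) ℝ := Matrix.of fun i j => hessEntry g x i j with hM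
  have hquad : ∀ v w : Fin e → ℝ, B v w = v ⬝ᵥ M.mulVec w := by
    intro v w
    have hv : ∀ v : Fin e → ℝ, v = ∑ i, v i • (Pi.single i 1 : Fin e → ℝ) := fun v => by
      ext j; simp [Finset.sum_apply, Pi.single_apply]
    conv_lhs => rw [hv v, hv w]
    simp only [map_sum, map_smul, sum_apply, smul_apply,
      dotProduct, Matrix.mulVec, hM, Matrix.of_apply, hentry, smul_eq_mul, Finset.mul_sum]
    rw [Finset.sum_comm]
    refine Finset.sum_congr rfl fun i _ => Finset.sum_congr rfl fun j _ => ?_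
    ring
  have hpsd : (-M).PosSemidef := by
    refine Matrix.PosSemidef.of_dotProduct_mulVec_nonneg ?_ ?_
    · ext i j
      simp only [Matrix.conjTranspose_apply, Matrix.neg_apply, hM, Matrix.of_apply, hentry]
      simp [hsymm (Pi.single i 1) (Pi.single j 1)]
    · intro v
      have := hneg v
      rw [hquad] at this
      simpa [Matrix.neg_mulVec] using this
  have hpd : (-M).PosDef := by
    rw [hpsd.posDef_iff_isUnit, Matrix.isUnit_iff_isUnit_det, Matrix.det_neg]
    simpa using hdet
  have hlt : ∀ v, v ≠ 0 → B v v < 0 := by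
    intro v hv
    have := hpd.dotProduct_mulVec_pos hv
    rw [hquad]
    simpa [Matrix.neg_mulVec] using this
  obtain ⟨c, hc, hcB⟩ : ∃ c > 0, ∀ v, B v v ≤ - c * ‖v‖ ^ 2 := by
    by_cases hne : (Metric.sphere (0 : Fin e → ℝ) 1).Nonempty
    · obtain ⟨u, hu, humax⟩ := (isCompact_sphere (0 : Fin e → ℝ) 1).exists_isMaxOn hne
        (f := fun v => B v v) (by fun_prop)
      have hu0 : u ≠ 0 := by rintro rfl; simp at hu
      refine ⟨-(B u u), by linarith [hlt u hu0], fun v => ?_⟩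
      by_cases hv : v = 0
      · simp [hv]
      · have hn : ‖v‖ ≠ 0 := by simpa using hv
        have := humax (show (‖v‖⁻¹ • v) ∈ Metric.sphere (0 : Fin e → ℝ) 1 by
          simp [norm_smul, hn])
        simp only [Set.mem_ofPred_eq, map_smul, smul_apply, smul_eq_mul] at this
        have h9 : B v v = ‖v‖ ^ 2 * (‖v‖⁻¹ * (‖v‖⁻¹ * B v v)) := by field_simp
        rw [h9, neg_neg, mul_comm (B u u)]
        gcongr
    · refine ⟨1, one_pos, fun v => ?_⟩
      by_cases hv : v = 0
      · simp [hv]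
      · exfalso; apply hne
        have hn : ‖v‖ ≠ 0 := by simpa using hv
        exact ⟨‖v‖⁻¹ • v, by simp [norm_smul, hn]⟩
  refine ⟨c / 4, by positivity, ?_⟩
  filter_upwards [htay (c / 4) (by positivity)] with y hy
  have := (abs_le.1 hy).2
  have := hcB (y - x)
  linarith

lemma factorial_upper (n : ℕ) (hn : 1 ≤ n) :
    (n.factorial : ℝ) ≤ exp 1 * √n * (n / exp 1) ^ n := by
  obtain ⟨m, rfl⟩ : ∃ m, n = m + 1 := ⟨n - 1, by omega⟩
  have h := Stirling.stirlingSeq'_antitone (Nat.zero_le m)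
  simp only [Function.comp, Nat.succ_eq_add_one, zero_add, Stirling.stirlingSeq_one] at h
  unfold Stirling.stirlingSeq at h
  rw [div_le_iff₀ (by positivity)] at h
  refine h.trans_eq ?_
  rw [Real.sqrt_mul (by norm_num)]
  field_simp

lemma factorial_lower (n : ℕ) :
    √(max (n : ℝ) 1) * (n / exp 1) ^ n ≤ (n.factorial : ℝ) := by
  rcases Nat.eq_zero_or_pos n with rfl | hn
  · simp
  · have h1 : (1 : ℝ) ≤ n := by exact_mod_cast hn
    refine le_trans ?_ (Stirling.le_factorial_stirling n)
    gcongr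
    rw [max_eq_left h1]
    nlinarith [Real.pi_gt_three]

lemma multi_bound (n : ℕ) (hn : 1 ≤ n) {k : ℕ} (z : Fin k → ℕ) (hz : ∑ i, z i = n) :
    (Nat.multinomial Finset.univ z : ℝ) * (∏ i, ((z i : ℝ) / n) ^ (z i)) *
      (∏ i, √(max (z i : ℝ) 1)) ≤ exp 1 * √n := by
  have hn0 : (0 : ℝ) < n := by exact_mod_cast hn
  have hspec : (∏ i, ((z i).factorial : ℝ)) * (Nat.multinomial Finset.univ z : ℝ)
      = (n.factorial : ℝ) := by
    rw [← hz]; exact_mod_cast Nat.multinomial_spec Finset.univ z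
  have hpow : ((n : ℝ) / exp 1) ^ n = ∏ i, ((n : ℝ) / exp 1) ^ (z i) := by
    rw [Finset.prod_pow_eq_pow_sum, hz]
  have hp : (∏ i, ((z i : ℝ) / n) ^ (z i)) * (∏ i, √(max (z i : ℝ) 1)) * ((n : ℝ) / exp 1) ^ n
      ≤ ∏ i, ((z i).factorial : ℝ) := by
    rw [hpow, ← Finset.prod_mul_distrib, ← Finset.prod_mul_distrib]
    refine Finset.prod_le_prod (fun i _ => by positivity) fun i _ => ?_
    refine le_trans (le_of_eq ?_) (factorial_lower (z i))
    have : (z i : ℝ) / exp 1 = (z i : ℝ) / n * (n / exp 1) := by field_simp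
    rw [this, mul_pow]; ring
  have hE : (0 : ℝ) < ((n : ℝ) / exp 1) ^ n := by positivity
  refine le_of_mul_le_mul_right ?_ hE
  calc _ = (Nat.multinomial Finset.univ z : ℝ) * ((∏ i, ((z i : ℝ) / n) ^ (z i)) *
      (∏ i, √(max (z i : ℝ) 1)) * ((n : ℝ) / exp 1) ^ n) := by ring
    _ ≤ (Nat.multinomial Finset.univ z : ℝ) * ∏ i, ((z i).factorial : ℝ) := by gcongr
    _ = n.factorial := by rw [mul_comm, hspec]
    _ ≤ _ := factorial_upper n hn

lemma geo_inj (q : ℝ) (h0 : 0 ≤ q) (h1 : q < 1) (S : Finset ℕ) (φ : ℕ → ℕ)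
    (hφ : Set.InjOn φ S) : ∑ k ∈ S, q ^ (φ k) ≤ (1 - q)⁻¹ := by
  rw [← Finset.sum_image (f := fun j => q ^ j) hφ, ← tsum_geometric_of_lt_one h0 h1]
  exact (summable_geometric_of_lt_one h0 h1).sum_le_tsum _ fun j _ => by positivity

lemma exp_sum (s : ℝ) (hs : 0 < s) (a : ℝ) (S : Finset ℕ) :
    ∑ k ∈ S, exp (-(s * |(k : ℝ) - a|)) ≤ 2 * ((1 + s) / s) := by
  set q := exp (-s) with hq
  have hq1 : q < 1 := by rw [hq]; simpa using hs
  have hq0 : 0 ≤ q := (exp_pos _).le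
  have hinv : (1 - q)⁻¹ ≤ (1 + s) / s := by
    rw [inv_le_comm₀ (by linarith) (by positivity), inv_div]
    have h2 : q ≤ 1 / (1 + s) := by
      rw [hq, Real.exp_neg, one_div]
      apply inv_anti₀ (by linarith)
      linarith [Real.add_one_le_exp s]
    have h3 : s / (1 + s) = 1 - 1 / (1 + s) := by field_simp; ring
    linarith
  have hpow : ∀ j : ℕ, q ^ j = exp (-(s * j)) := by
    intro j; rw [hq, ← Real.exp_nat_mul]; congr 1; ring
  set m := ⌊a⌋ with hm
  have hma : (m : ℝ) ≤ a := Int.floor_le a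
  have ham : a < m + 1 := Int.lt_floor_add_one a
  rw [← Finset.sum_filter_add_sum_filter_not S (fun k : ℕ => (k : ℤ) ≤ m)]
  have hA : ∑ k ∈ S.filter (fun k : ℕ => (k : ℤ) ≤ m), exp (-(s * |(k : ℝ) - a|))
      ≤ (1 - q)⁻¹ := by
    refine le_trans (Finset.sum_le_sum fun k hk => ?_)
      (geo_inj q hq0 hq1 (S.filter (fun k : ℕ => (k : ℤ) ≤ m)) (fun k => (m - k).toNat) ?_)
    · have hk := (Finset.mem_filter.1 hk).2
      rw [hpow]
      have h4 : (((m - k).toNat : ℕ) : ℝ) = (m : ℝ) - k := by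
        have : (((m - k).toNat : ℕ) : ℤ) = m - k := Int.toNat_of_nonneg (by omega)
        exact_mod_cast congrArg (Int.cast : ℤ → ℝ) this
      rw [h4]
      apply Real.exp_le_exp.2
      apply neg_le_neg
      apply mul_le_mul_of_nonneg_left _ hs.le
      rw [abs_sub_comm]
      exact le_trans (by linarith) (le_abs_self _)
    · intro x hx y hy hxy
      simp at hx hy hxy
      omega
  have hB : ∑ k ∈ S.filter (fun k : ℕ => ¬ (k : ℤ) ≤ m), exp (-(s * |(k : ℝ) - a|))
      ≤ (1 - q)⁻¹ := by
    refine le_trans (Finset.sum_le_sum fun k hk => ?_)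
      (geo_inj q hq0 hq1 (S.filter (fun k : ℕ => ¬ (k : ℤ) ≤ m)) (fun k => (k - m - 1).toNat) ?_)
    · have hk := (Finset.mem_filter.1 hk).2
      rw [hpow]
      have h4 : (((k - m - 1).toNat : ℕ) : ℝ) = (k : ℝ) - m - 1 := by
        have : (((k - m - 1).toNat : ℕ) : ℤ) = k - m - 1 := Int.toNat_of_nonneg (by omega)
        exact_mod_cast congrArg (Int.cast : ℤ → ℝ) this
      rw [h4]
      apply Real.exp_le_exp.2
      apply neg_le_neg
      apply mul_le_mul_of_nonneg_left _ hs.le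
      exact le_trans (by linarith) (le_abs_self _)
    · intro x hx y hy hxy
      simp at hx hy hxy
      omega
  linarith

lemma ball_bound {e : ℕ} (he : 1 ≤ e) (ζ : Fin e → ℝ) (ρ : ℝ) (hρ : 0 < ρ)
    (h : Metric.ball ζ ρ ⊆ {ζ : Fin e → ℝ | (∀ i, 0 ≤ ζ i) ∧ ∑ i, ζ i ≤ 1}) :
    (∀ i, ρ / 2 ≤ ζ i) ∧ ρ / 2 ≤ 1 - ∑ i, ζ i := by
  have key : ∀ (i : Fin e) (t : ℝ), |t| < ρ → ζ + Pi.single i t ∈ Metric.ball ζ ρ := by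
    intro i t ht
    simpa [dist_eq_norm, Pi.norm_single] using ht
  constructor
  · intro i
    have := (h (key i (-(ρ / 2)) (by rw [abs_neg, abs_of_pos] <;> linarith))).1 i
    simp at this
    linarith
  · have := (h (key ⟨0, he⟩ (ρ / 2) (by rw [abs_of_pos] <;> linarith))).2
    simp [Finset.sum_add_distrib] at this
    linarith

lemma rpow_self_eq (x : ℝ) (hx : 0 ≤ x) : x ^ x = exp (x * log x) := by
  rcases hx.eq_or_lt with rfl | hx
  · simp
  · rw [Real.rpow_def_of_pos hx, mul_comm]

lemma poly_exp (k : ℕ) (c : ℝ) (hc : 0 < c) (n : ℕ) (hn : 1 ≤ n) :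
    √(n : ℝ) ^ k ≤ (k.factorial / c ^ k) * exp (c * n) := by
  have h1 : (1 : ℝ) ≤ n := by exact_mod_cast hn
  have h2 : √(n : ℝ) ≤ n := by
    rw [Real.sqrt_le_left (by linarith)]; nlinarith
  have h3 := Real.pow_div_factorial_le_exp (c * n) (by positivity) k
  calc √(n : ℝ) ^ k ≤ (n : ℝ) ^ k := by gcongr
    _ = (k.factorial / c ^ k) * ((c * n) ^ k / k.factorial) := by
        rw [mul_pow]; field_simp
    _ ≤ _ := by gcongr

lemma global_bound {e : ℕ} (he : 1 ≤ e)
    (Z : Set (Fin e → ℝ))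
    (hZ : Z = {ζ : Fin e → ℝ | (∀ i, 0 ≤ ζ i) ∧ ∑ i, ζ i ≤ 1})
    (f : (Fin e → ℝ) → ℝ)
    (hf_analytic : AnalyticOnNhd ℝ f Z)
    (hf_pos : ∀ ζ ∈ Z, 0 < f ζ)
    (g : (Fin e → ℝ) → ℝ)
    (hg : ∀ ζ : Fin e → ℝ,
      g ζ = f ζ / ((∏ i, ζ i ^ ζ i) * (1 - ∑ i, ζ i) ^ (1 - ∑ i, ζ i)))
    (ζmax : Fin e → ℝ)
    (hζmax : ζmax ∈ interior Z)
    (hunique : ∀ ζ ∈ Z, ζ ≠ ζmax → g ζ < g ζmax)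
    (hdet : Matrix.det (Matrix.of fun i j => hessEntry g ζmax i j) ≠ 0) :
    0 < g ζmax ∧ ∃ c > 0, ∀ ζ ∈ Z, g ζ ≤ g ζmax * exp (-(c * ‖ζ - ζmax‖ ^ 2)) := by
  have hmem : ζmax ∈ Z := interior_subset hζmax
  have hnhds : Z ∈ nhds ζmax := mem_interior_iff_mem_nhds.1 hζmax
  obtain ⟨ρ, hρ, hball⟩ := Metric.mem_nhds_iff.1 hnhds
  obtain ⟨hb1, hb2⟩ := ball_bound he ζmax ρ hρ (hZ ▸ hball)
  have hcoord : ∀ ζ ∈ Z, ∀ i, 0 ≤ ζ i ∧ ζ i ≤ 1 := by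
    intro ζ hζ i
    rw [hZ] at hζ
    refine ⟨hζ.1 i, le_trans ?_ hζ.2⟩
    exact Finset.single_le_sum (fun j _ => hζ.1 j) (Finset.mem_univ i)
  have hgpos : 0 < g ζmax := by
    rw [hg]
    apply div_pos (hf_pos _ hmem)
    apply mul_pos
    · exact Finset.prod_pos fun i _ => Real.rpow_pos_of_pos (by linarith [hb1 i]) _
    · exact Real.rpow_pos_of_pos (by linarith) _
  refine ⟨hgpos, ?_⟩
  have hsmooth : ContDiffAt ℝ 2 g ζmax := by
    have : g = fun ζ => f ζ / ((∏ i, ζ i ^ ζ i) * (1 - ∑ i, ζ i) ^ (1 - ∑ i, ζ i)) :=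
      funext hg
    rw [this]
    have hc : ∀ i, ContDiffAt ℝ 2 (fun ζ : Fin e → ℝ => ζ i) ζmax := fun i => by fun_prop
    have hl : ContDiffAt ℝ 2 (fun ζ : Fin e → ℝ => 1 - ∑ i, ζ i) ζmax := by fun_prop
    refine ContDiffAt.div (hf_analytic _ hmem).contDiffAt (ContDiffAt.mul ?_ ?_) ?_
    · exact contDiffAt_prod fun i _ => (hc i).rpow (hc i) (by linarith [hb1 i])
    · exact hl.rpow hl (by linarith)
    · apply ne_of_gt
      apply mul_pos
      · exact Finset.prod_pos fun i _ => Real.rpow_pos_of_pos (by linarith [hb1 i]) _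
      · exact Real.rpow_pos_of_pos (by linarith) _
  have hmax : IsLocalMax g ζmax := by
    filter_upwards [hnhds] with ζ hζ
    by_cases h : ζ = ζmax
    · rw [h]
    · exact (hunique ζ hζ h).le
  obtain ⟨c₁, hc₁, hev⟩ := quad_max g ζmax hsmooth hmax hdet
  obtain ⟨r, hr, hrb⟩ := Metric.eventually_nhds_iff_ball.1 hev
  have hZclosed : IsClosed Z := by
    have : Z = (⋂ i, {ζ : Fin e → ℝ | 0 ≤ ζ i}) ∩ {ζ : Fin e → ℝ | ∑ i, ζ i ≤ 1} := by
      rw [hZ]; ext; simp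
    rw [this]
    refine (isClosed_iInter fun i => ?_).inter ?_
    · exact isClosed_le continuous_const (continuous_apply i)
    · exact isClosed_le (by fun_prop) continuous_const
  have hnorm : ∀ ζ ∈ Z, ‖ζ - ζmax‖ ≤ 1 := by
    intro ζ hζ
    rw [pi_norm_le_iff_of_nonneg zero_le_one]
    intro i
    have h1 := hcoord ζ hζ i
    have h2 := hcoord ζmax hmem i
    rw [Pi.sub_apply, Real.norm_eq_abs, abs_le]
    constructor <;> linarith [h1.1, h1.2, h2.1, h2.2]
  have hZcompact : IsCompact Z := by
    refine Metric.isCompact_of_isClosed_isBounded hZclosed ?_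
    refine (Metric.isBounded_closedBall (x := ζmax) (r := 1)).subset fun ζ hζ => ?_
    simpa [dist_eq_norm] using hnorm ζ hζ
  have hgcont : ContinuousOn g Z := by
    have heq : Set.EqOn g (fun ζ => f ζ / ((∏ i, exp (ζ i * log (ζ i))) *
        exp ((1 - ∑ i, ζ i) * log (1 - ∑ i, ζ i)))) Z := by
      intro ζ hζ
      have h1 := hcoord ζ hζ
      have h2 : 0 ≤ 1 - ∑ i, ζ i := by rw [hZ] at hζ; linarith [hζ.2]
      simp only [hg ζ]
      rw [rpow_self_eq _ h2, Finset.prod_congr rfl fun i _ => rpow_self_eq _ (h1 i).1]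
    refine ContinuousOn.congr ?_ heq
    refine hf_analytic.continuousOn.div (Continuous.continuousOn ?_) fun ζ _ => by positivity
    refine Continuous.mul (continuous_finsetProd _ fun i _ => ?_) ?_
    · exact Real.continuous_exp.comp (Real.continuous_mul_log.comp (continuous_apply i))
    · exact Real.continuous_exp.comp (Real.continuous_mul_log.comp (by fun_prop))
  obtain ⟨η, hη, hηb⟩ : ∃ η > 0, ∀ ζ ∈ Z, ζ ∉ Metric.ball ζmax r → g ζ ≤ g ζmax - η := by
    have hK : IsCompact (Z \ Metric.ball ζmax r) := hZcompact.diff Metric.isOpen_ball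
    by_cases hne : (Z \ Metric.ball ζmax r).Nonempty
    · obtain ⟨u, hu, humax⟩ := hK.exists_isMaxOn hne (hgcont.mono Set.sdiff_subset)
      have hune : u ≠ ζmax := by
        rintro rfl; exact hu.2 (Metric.mem_ball_self hr)
      refine ⟨g ζmax - g u, by linarith [hunique u hu.1 hune], fun ζ hζ hζb => ?_⟩
      have := humax (show ζ ∈ Z \ Metric.ball ζmax r from ⟨hζ, hζb⟩)
      simp only [Set.mem_ofPred_eq] at this
      linarith
    · exact ⟨1, one_pos, fun ζ hζ hζb => (hne ⟨ζ, hζ, hζb⟩).elim⟩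
  set c₂ := min c₁ η with hc₂
  have hc₂0 : 0 < c₂ := lt_min hc₁ hη
  refine ⟨c₂ / g ζmax, by positivity, fun ζ hζ => ?_⟩
  have hmain : g ζ ≤ g ζmax - c₂ * ‖ζ - ζmax‖ ^ 2 := by
    by_cases hb : ζ ∈ Metric.ball ζmax r
    · have h1 := hrb ζ hb
      have : c₂ * ‖ζ - ζmax‖ ^ 2 ≤ c₁ * ‖ζ - ζmax‖ ^ 2 := by gcongr; exact min_le_left _ _
      linarith
    · have h1 := hηb ζ hζ hb
      have h2 : ‖ζ - ζmax‖ ^ 2 ≤ 1 := pow_le_one₀ (norm_nonneg _) (hnorm ζ hζ)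
      have : c₂ * ‖ζ - ζmax‖ ^ 2 ≤ η * 1 := by
        gcongr; exact min_le_right _ _
      linarith
  have h3 := Real.add_one_le_exp (-(c₂ / g ζmax * ‖ζ - ζmax‖ ^ 2))
  calc g ζ ≤ g ζmax - c₂ * ‖ζ - ζmax‖ ^ 2 := hmain
    _ = g ζmax * (-(c₂ / g ζmax * ‖ζ - ζmax‖ ^ 2) + 1) := by field_simp; ring
    _ ≤ _ := by gcongr

lemma rpow_nat_aux (k n : ℕ) (hn : 1 ≤ n) :
    ((((k : ℝ) / n) ^ ((k : ℝ) / n) : ℝ)) ^ n = ((k : ℝ) / n) ^ k := by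
  have hn0 : (n : ℝ) ≠ 0 := by positivity
  rw [← Real.rpow_natCast, ← Real.rpow_mul (by positivity), div_mul_cancel₀ _ hn0,
    Real.rpow_natCast]

lemma laplace_main {e : ℕ} (he : 1 ≤ e)
    (Z : Set (Fin e → ℝ))
    (hZ : Z = {ζ : Fin e → ℝ | (∀ i, 0 ≤ ζ i) ∧ ∑ i, ζ i ≤ 1})
    (f : (Fin e → ℝ) → ℝ)
    (hf_analytic : AnalyticOnNhd ℝ f Z)
    (hf_pos : ∀ ζ ∈ Z, 0 < f ζ)
    (g : (Fin e → ℝ) → ℝ)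
    (hg : ∀ ζ : Fin e → ℝ,
      g ζ = f ζ / ((∏ i, ζ i ^ ζ i) * (1 - ∑ i, ζ i) ^ (1 - ∑ i, ζ i)))
    (ζmax : Fin e → ℝ)
    (hζmax : ζmax ∈ interior Z)
    (hunique : ∀ ζ ∈ Z, ζ ≠ ζmax → g ζ < g ζmax)
    (hdet : Matrix.det (Matrix.of fun i j => hessEntry g ζmax i j) ≠ 0) :
    ∃ D : ℝ, ∀ᶠ n : ℕ in atTop,
      (∑ z ∈ Finset.Nat.antidiagonalTuple (e + 1) n, (Nat.multinomial Finset.univ z : ℝ) *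
        f (fun i => (z i.castSucc : ℝ) / n) ^ n) < D * g ζmax ^ n := by
  obtain ⟨hgpos, c, hc, hgb⟩ := global_bound he Z hZ f hf_analytic hf_pos g hg ζmax hζmax
    hunique hdet
  obtain ⟨ρ, hρ, hball⟩ := Metric.mem_nhds_iff.1 (mem_interior_iff_mem_nhds.1 hζmax)
  set K₁ := exp 1 / √(ρ / 4) ^ (e + 1) with hK₁
  set a := c * ρ ^ 2 / 8 with ha
  have ha0 : 0 < a := by positivity
  set K₂ := exp 1 * ((e + 1).factorial / a ^ (e + 1)) with hK₂
  set K := max K₁ K₂ with hK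
  have hK₁0 : 0 < K₁ := by positivity
  have hK0 : 0 < K := lt_of_lt_of_le hK₁0 (le_max_left _ _)
  set Kprod := K * exp (1 / (2 * c)) with hKprod
  refine ⟨Kprod * (2 * (1 + e)) ^ e + 1, ?_⟩
  filter_upwards [eventually_ge_atTop 1] with n hn
  have hn1 : (1 : ℝ) ≤ n := by exact_mod_cast hn
  have hn0 : (0 : ℝ) < n := by linarith
  have he1 : (1 : ℝ) ≤ e := by exact_mod_cast he
  have hsn : 1 ≤ √(n : ℝ) := Real.one_le_sqrt.2 hn1
  set s : ℝ := 1 / (e * √(n : ℝ)) with hs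
  have hs0 : 0 < s := by positivity
  -- the bound for a single term
  have hterm : ∀ z ∈ Finset.Nat.antidiagonalTuple (e + 1) n,
      (Nat.multinomial Finset.univ z : ℝ) * f (fun i => (z i.castSucc : ℝ) / n) ^ n ≤
      (g ζmax ^ n * Kprod / √(n : ℝ) ^ e) *
        ∏ i : Fin e, exp (-(s * |(z i.castSucc : ℝ) - n * ζmax i|)) := by
    intro z hz
    have hzsum : ∑ j, z j = n := Finset.Nat.mem_antidiagonalTuple.1 hz
    set ζ : Fin e → ℝ := fun i => (z i.castSucc : ℝ) / n with hζ
    have hlast : 1 - ∑ i, ζ i = (z (Fin.last e) : ℝ) / n := by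
      have h1 : ∑ i : Fin e, (z i.castSucc : ℝ) + z (Fin.last e) = n := by
        rw [Fin.sum_univ_castSucc] at hzsum
        exact_mod_cast hzsum
      rw [hζ]
      simp only
      rw [← Finset.sum_div, ← h1]
      have : ∑ i : Fin e, (z i.castSucc : ℝ) + z (Fin.last e) ≠ 0 := by rw [h1]; positivity
      field_simp
      ring
    have hζZ : ζ ∈ Z := by
      rw [hZ]
      refine ⟨fun i => by positivity, ?_⟩
      have : 0 ≤ (z (Fin.last e) : ℝ) / n := by positivity
      linarith
    set P := (Nat.multinomial Finset.univ z : ℝ) * (∏ j, ((z j : ℝ) / n) ^ (z j)) with hP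
    have hP0 : 0 ≤ P := by positivity
    have hPb := multi_bound n hn z hzsum
    rw [← hP] at hPb
    have hden : ((∏ i, ζ i ^ ζ i) * (1 - ∑ i, ζ i) ^ (1 - ∑ i, ζ i)) ^ n
        = ∏ j, ((z j : ℝ) / n) ^ (z j) := by
      rw [Fin.prod_univ_castSucc, hlast, mul_pow, rpow_nat_aux _ n hn, ← Finset.prod_pow]
      congr 1
      exact Finset.prod_congr rfl fun i _ => rpow_nat_aux _ n hn
    have hpj : ∀ j, (0 : ℝ) < ((z j : ℝ) / n) ^ (z j) := by
      intro j
      rcases Nat.eq_zero_or_pos (z j) with h | h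
      · rw [h]; simp
      · have : (0 : ℝ) < z j := by exact_mod_cast h
        positivity
    have hden0 : ((∏ i, ζ i ^ ζ i) * (1 - ∑ i, ζ i) ^ (1 - ∑ i, ζ i)) ≠ 0 := by
      intro h
      rw [h, zero_pow (by omega)] at hden
      exact (Finset.prod_pos fun j _ => hpj j).ne hden
    have hfg : f ζ ^ n = g ζ ^ n * ∏ j, ((z j : ℝ) / n) ^ (z j) := by
      rw [← hden, ← mul_pow, hg ζ, div_mul_cancel₀ _ hden0]
    have hgnn : 0 ≤ g ζ := by
      rw [hg]
      refine div_nonneg (hf_pos _ hζZ).le (mul_nonneg ?_ ?_)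
      · exact Finset.prod_nonneg fun i _ => Real.rpow_nonneg (by positivity) _
      · rw [hlast]; positivity
    set δ := ‖ζ - ζmax‖ with hδ
    have hδ0 : 0 ≤ δ := norm_nonneg _
    have hgn : g ζ ^ n ≤ g ζmax ^ n * exp (-(c * n * δ ^ 2)) := by
      calc g ζ ^ n ≤ (g ζmax * exp (-(c * δ ^ 2))) ^ n := by gcongr; exact hgb ζ hζZ
        _ = _ := by
          rw [mul_pow, ← Real.exp_nat_mul]; congr 2; ring
    have hPE : P * exp (-(c * n * δ ^ 2)) * √(n : ℝ) ^ e
        ≤ K * exp (-(c / 2 * n * δ ^ 2)) := by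
      by_cases hnear : δ < ρ / 2
      · have hsub : Metric.ball ζ (ρ / 2) ⊆
            {ζ : Fin e → ℝ | (∀ i, 0 ≤ ζ i) ∧ ∑ i, ζ i ≤ 1} := by
          rw [← hZ]
          refine subset_trans ?_ hball
          apply Metric.ball_subset_ball'
          rw [dist_eq_norm]
          linarith
        obtain ⟨hb1, hb2⟩ := ball_bound he ζ (ρ / 2) (by positivity) hsub
        rw [hlast] at hb2
        have hbj : ∀ j, ρ / 4 * n ≤ z j := by
          intro j
          refine Fin.lastCases ?_ (fun i => ?_) j
          · rw [le_div_iff₀ hn0] at hb2; linarith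
          · have := hb1 i
            rw [hζ] at this
            simp only at this
            rw [le_div_iff₀ hn0] at this; linarith
        have hprod : √(ρ / 4) ^ (e + 1) * √(n : ℝ) ^ (e + 1) ≤ ∏ j, √(max (z j : ℝ) 1) := by
          rw [← mul_pow, ← Real.sqrt_mul (by positivity)]
          calc √(ρ / 4 * n) ^ (e + 1) = ∏ j : Fin (e + 1), √(ρ / 4 * n) := by simp
            _ ≤ _ := Finset.prod_le_prod (fun _ _ => by positivity) fun j _ => by
                gcongr; exact (hbj j).trans (le_max_left _ _)
        have h1 : P * (√(ρ / 4) ^ (e + 1) * √(n : ℝ) ^ (e + 1)) ≤ exp 1 * √n :=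
          le_trans (by gcongr) hPb
        have h2 : P * √(n : ℝ) ^ e ≤ K₁ := by
          rw [hK₁, le_div_iff₀ (by positivity)]
          refine le_of_mul_le_mul_right ?_ (show 0 < √(n : ℝ) by linarith)
          calc _ = P * (√(ρ / 4) ^ (e + 1) * √(n : ℝ) ^ (e + 1)) := by ring
            _ ≤ _ := h1
        have h3 : exp (-(c * n * δ ^ 2)) ≤ exp (-(c / 2 * n * δ ^ 2)) := by
          apply Real.exp_le_exp.2
          have : 0 ≤ c * n * δ ^ 2 := by positivity
          linarith
        calc _ = (P * √(n : ℝ) ^ e) * exp (-(c * n * δ ^ 2)) := by ring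
          _ ≤ K * exp (-(c / 2 * n * δ ^ 2)) := by
            gcongr
            exact h2.trans (le_max_left _ _)
      · push Not at hnear
        have h1 : P ≤ exp 1 * √n := by
          refine le_trans ?_ hPb
          refine le_mul_of_one_le_right hP0 ?_
          calc (1 : ℝ) = ∏ j : Fin (e + 1), 1 := by simp
            _ ≤ _ := Finset.prod_le_prod (fun _ _ => by positivity) fun j _ =>
              Real.one_le_sqrt.2 (le_max_right _ _)
        have h2 := poly_exp (e + 1) a ha0 n hn
        have h3 : exp (-(c * n * δ ^ 2)) ≤ exp (-(a * n)) * exp (-(c / 2 * n * δ ^ 2)) := by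
          rw [← Real.exp_add]
          apply Real.exp_le_exp.2
          have : (ρ / 2) ^ 2 ≤ δ ^ 2 := by gcongr
          have : c * n / 2 * (ρ / 2) ^ 2 ≤ c * n / 2 * δ ^ 2 := by gcongr
          rw [ha]
          linarith
        calc P * exp (-(c * n * δ ^ 2)) * √(n : ℝ) ^ e
            ≤ (exp 1 * √n) * (exp (-(a * n)) * exp (-(c / 2 * n * δ ^ 2))) * √(n : ℝ) ^ e := by
              gcongr
          _ = exp 1 * √(n : ℝ) ^ (e + 1) * exp (-(a * n)) * exp (-(c / 2 * n * δ ^ 2)) := by ring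
          _ ≤ exp 1 * ((e + 1).factorial / a ^ (e + 1) * exp (a * n)) * exp (-(a * n))
                * exp (-(c / 2 * n * δ ^ 2)) := by gcongr
          _ = K₂ * exp (-(c / 2 * n * δ ^ 2)) * (exp (a * n) * exp (-(a * n))) := by
              rw [hK₂]; ring
          _ = K₂ * exp (-(c / 2 * n * δ ^ 2)) := by
              rw [← Real.exp_add]; simp
          _ ≤ _ := by gcongr; exact le_max_right _ _
    have hexp : exp (-(c / 2 * n * δ ^ 2)) ≤ exp (1 / (2 * c)) *
        ∏ i : Fin e, exp (-(s * |(z i.castSucc : ℝ) - n * ζmax i|)) := by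
      rw [← Real.exp_sum, ← Real.exp_add]
      apply Real.exp_le_exp.2
      have h1 : ∑ i : Fin e, s * |(z i.castSucc : ℝ) - n * ζmax i| ≤ √(n : ℝ) * δ := by
        have h2 : ∀ i ∈ Finset.univ, s * |(z i.castSucc : ℝ) - n * ζmax i| ≤
            1 / e * (√(n : ℝ) * δ) := by
          intro i _
          have h3 : |(z i.castSucc : ℝ) - n * ζmax i| = n * |ζ i - ζmax i| := by
            have : (z i.castSucc : ℝ) - n * ζmax i = n * (ζ i - ζmax i) := by
              rw [hζ]; field_simp
            rw [this, abs_mul, abs_of_pos hn0]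
          have h4 : |ζ i - ζmax i| ≤ δ := by
            have := norm_le_pi_norm (ζ - ζmax) i
            simpa using this
          have h5 : s * n = 1 / e * √(n : ℝ) := by
            rw [hs]
            have := Real.mul_self_sqrt hn0.le
            field_simp
            linarith [sq (√(n : ℝ))]
          rw [h3, ← mul_assoc, h5, mul_assoc]
          gcongr
        refine (Finset.sum_le_sum h2).trans ?_
        simp
        rw [← mul_assoc, mul_inv_cancel₀ (by positivity), one_mul]
      have h6 : √(n : ℝ) * δ ≤ c / 2 * n * δ ^ 2 + 1 / (2 * c) := by
        have h7 := sq_nonneg (c * (√(n : ℝ) * δ) - 1)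
        have h8 : c / 2 * n * δ ^ 2 + 1 / (2 * c) - √(n : ℝ) * δ
            = (c * (√(n : ℝ) * δ) - 1) ^ 2 / (2 * c) := by
          have h9 : (n : ℝ) = √(n : ℝ) ^ 2 := (Real.sq_sqrt hn0.le).symm
          conv_lhs => rw [h9]
          rw [Real.sqrt_sq (by positivity)]
          field_simp
          ring
        have : 0 ≤ (c * (√(n : ℝ) * δ) - 1) ^ 2 / (2 * c) := by positivity
        linarith
      rw [Finset.sum_neg_distrib]
      linarith
    have hsne : 0 < √(n : ℝ) ^ e := by positivity
    rw [hfg]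
    calc _ = P * g ζ ^ n := by rw [hP]; ring
      _ ≤ P * (g ζmax ^ n * exp (-(c * n * δ ^ 2))) := by gcongr
      _ = g ζmax ^ n / √(n : ℝ) ^ e * (P * exp (-(c * n * δ ^ 2)) * √(n : ℝ) ^ e) := by
          field_simp
      _ ≤ g ζmax ^ n / √(n : ℝ) ^ e * (K * (exp (1 / (2 * c)) *
        ∏ i : Fin e, exp (-(s * |(z i.castSucc : ℝ) - n * ζmax i|)))) := by
          exact mul_le_mul_of_nonneg_left
            (hPE.trans (mul_le_mul_of_nonneg_left hexp hK0.le)) (by positivity)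
      _ = _ := by rw [hKprod]; ring
  have hsum : ∑ z ∈ Finset.Nat.antidiagonalTuple (e + 1) n,
      ∏ i : Fin e, exp (-(s * |(z i.castSucc : ℝ) - n * ζmax i|))
      ≤ (2 * (1 + e)) ^ e * √(n : ℝ) ^ e := by
    have hinj : Set.InjOn (fun (z : Fin (e + 1) → ℕ) (i : Fin e) => z i.castSucc)
        (Finset.Nat.antidiagonalTuple (e + 1) n : Set (Fin (e + 1) → ℕ)) := by
      intro x hx y hy hxy
      have hx := Finset.Nat.mem_antidiagonalTuple.1 hx
      have hy := Finset.Nat.mem_antidiagonalTuple.1 hy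
      rw [Fin.sum_univ_castSucc] at hx hy
      have hxy' : ∀ i : Fin e, x i.castSucc = y i.castSucc := fun i => congrFun hxy i
      simp only [hxy'] at hx
      funext j
      refine Fin.lastCases ?_ (fun i => hxy' i) j
      omega
    have h1 := Finset.sum_image (f := fun w : Fin e → ℕ =>
      ∏ i : Fin e, exp (-(s * |(w i : ℝ) - n * ζmax i|))) hinj
    rw [← h1]
    calc _ ≤ ∑ w ∈ Fintype.piFinset (fun _ : Fin e => Finset.range (n + 1)),
          ∏ i : Fin e, exp (-(s * |(w i : ℝ) - n * ζmax i|)) := by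
          refine Finset.sum_le_sum_of_subset_of_nonneg ?_ fun _ _ _ => by positivity
          intro w hw
          obtain ⟨z, hz, rfl⟩ := Finset.mem_image.1 hw
          have hz := Finset.Nat.mem_antidiagonalTuple.1 hz
          rw [Fintype.mem_piFinset]
          intro i
          rw [Finset.mem_range, ← hz]
          exact Nat.lt_succ_of_le
            (Finset.single_le_sum (f := z) (fun _ _ => Nat.zero_le _) (Finset.mem_univ _))
      _ = ∏ i : Fin e, ∑ k ∈ Finset.range (n + 1), exp (-(s * |(k : ℝ) - n * ζmax i|)) :=
          (Finset.prod_univ_sum (fun _ : Fin e => Finset.range (n + 1))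
            (fun i k => exp (-(s * |(k : ℝ) - n * ζmax i|)))).symm
      _ ≤ ∏ i : Fin e, (2 * (1 + e) * √(n : ℝ)) := by
          refine Finset.prod_le_prod (fun _ _ => by positivity) fun i _ => ?_
          refine (exp_sum s hs0 _ _).trans ?_
          have : (1 + s) / s = e * √(n : ℝ) + 1 := by rw [hs]; field_simp
          rw [this]
          nlinarith
      _ = _ := by rw [Finset.prod_const, mul_pow]; simp
  have hgn0 : 0 < g ζmax ^ n := by positivity
  have hsne : 0 < √(n : ℝ) ^ e := by positivity
  calc _ ≤ ∑ z ∈ Finset.Nat.antidiagonalTuple (e + 1) n, (g ζmax ^ n * Kprod / √(n : ℝ) ^ e) *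
        ∏ i : Fin e, exp (-(s * |(z i.castSucc : ℝ) - n * ζmax i|)) := Finset.sum_le_sum hterm
    _ ≤ (g ζmax ^ n * Kprod / √(n : ℝ) ^ e) * ((2 * (1 + e)) ^ e * √(n : ℝ) ^ e) := by
        rw [← Finset.mul_sum]
        gcongr
    _ = Kprod * (2 * (1 + e)) ^ e * g ζmax ^ n := by field_simp
    _ < _ := by linarith

/-- Lemma 5 of the paper: a multidimensional Laplace-method upper bound for multinomial
sums.  Here `Z` is the simplex in ℝ^{d−1}, `f` is positive and real-analytic on `Z`,
`g(ζ) = f(ζ)/(ζ₁^{ζ₁}⋯ζ_{d−1}^{ζ_{d−1}}(1−Σζ_i)^{1−Σζ_i})` (with `0^0 = 1`, satisfied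
by `Real.rpow`), `g` has a unique maximum `g_max` attained at `ζ_max` in the interior of
`Z`, and the Hessian determinant of `g` at `ζ_max` is nonzero.  Then
`S_n = Σ_{z₁+⋯+z_d=n} (n!/(z₁!⋯z_d!)) f(z₁/n,…,z_{d−1}/n)^n < D g_max^n` for all
sufficiently large `n`. -/
theorem multinomial_sum_laplace_bound (d : ℕ) (hd : 2 ≤ d)
    (Z : Set (Fin (d - 1) → ℝ))
    (hZ : Z = {ζ : Fin (d - 1) → ℝ | (∀ i, 0 ≤ ζ i) ∧ ∑ i, ζ i ≤ 1})
    (f : (Fin (d - 1) → ℝ) → ℝ)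
    (hf_analytic : AnalyticOnNhd ℝ f Z)
    (hf_pos : ∀ ζ ∈ Z, 0 < f ζ)
    (g : (Fin (d - 1) → ℝ) → ℝ)
    (hg : ∀ ζ : Fin (d - 1) → ℝ,
      g ζ = f ζ / ((∏ i, ζ i ^ ζ i) * (1 - ∑ i, ζ i) ^ (1 - ∑ i, ζ i)))
    (ζmax : Fin (d - 1) → ℝ) (gmax : ℝ)
    (hζmax : ζmax ∈ interior Z) (hgmax : g ζmax = gmax)
    (hunique : ∀ ζ ∈ Z, ζ ≠ ζmax → g ζ < gmax)
    (hdet : Matrix.det (Matrix.of fun i j => hessEntry g ζmax i j) ≠ 0) :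
    ∃ D : ℝ, ∀ᶠ n : ℕ in atTop,
      (∑ z ∈ Finset.Nat.antidiagonalTuple d n, (Nat.multinomial Finset.univ z : ℝ) *
        f (fun i => (z (Fin.castLE (by omega) i) : ℝ) / n) ^ n) < D * gmax ^ n := by
  obtain ⟨e, rfl⟩ : ∃ e, d = e + 1 := ⟨d - 1, by omega⟩
  subst hgmax
  exact laplace_main (e := e) (by omega) Z hZ f hf_analytic hf_pos g hg ζmax hζmax hunique hdet
end

section
/- For every ε > 0 there exists k₀ = k₀(ε) such that for all integers k ≥ k₀ and every real r with 0 < r ≤ 2^{k-1} ln 2 − (ln 2)/2 − (1+ε)/2: g_r(1/2, 1/2, 1/4) = 1, g_r(α,β,γ) < 1 for every (α,β,γ) in the domain with (α,β,γ) ≠ (1/2,1/2,1/4), and moreover the determinant of the 3×3 matrix of second partial derivatives, at (ζ₁,ζ₂,ζ₃) = (1/4,1/4,1/4), of the function (ζ₁,ζ₂,ζ₃) ↦ g_r(ζ₁+ζ₂, ζ₁+ζ₃, ζ₁) is nonzero. -/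
open Real

/-- `p(α,β,γ)`: the probability that a random `k`-subset is bichromatic under both of a
pair of colorings with black densities `α`, `β` and overlap `γ`. -/
noncomputable def hypP (k : ℕ) (α β γ : ℝ) : ℝ :=
  1 - α ^ k - (1 - α) ^ k - β ^ k - (1 - β) ^ k + γ ^ k + (α - γ) ^ k
    + (β - γ) ^ k + (1 - α - β + γ) ^ k

/-- The second-moment rate function
`g_r(α,β,γ) = (p(α,β,γ)/q²)^r / (4 γ^γ (α−γ)^{α−γ} (β−γ)^{β−γ} (1−α−β+γ)^{1−α−β+γ})`
with `q = 1 − 2^{1−k}` and the convention `0^0 = 1` (satisfied by `Real.rpow`). -/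
noncomputable def hypG (k : ℕ) (r : ℝ) (α β γ : ℝ) : ℝ :=
  (hypP k α β γ / (1 - (2 : ℝ) ^ (1 - (k : ℝ))) ^ 2) ^ r /
    (4 * γ ^ γ * (α - γ) ^ (α - γ) * (β - γ) ^ (β - γ) *
      (1 - α - β + γ) ^ (1 - α - β + γ))

theorem aux_XD (k : ℕ) (t u : ℝ) (ht : 0 ≤ t) (ht1 : t ≤ 1) (hu : 0 ≤ u) :
    (0 ≤ (t + u) ^ k + (t - u) ^ k - 2 * t ^ k ∧ 0 ≤ (t + u) ^ k - (t - u) ^ k) ∧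
    ((t + u) ^ k + (t - u) ^ k - 2 * t ^ k ≤ (1 + u) ^ k + (1 - u) ^ k - 2 ∧
     (t + u) ^ k - (t - u) ^ k ≤ (1 + u) ^ k - (1 - u) ^ k) := by
  induction k with
  | zero => norm_num
  | succ n ih =>
    obtain ⟨⟨h1, h2⟩, h3, h4⟩ := ih
    have e1 : (t + u) ^ (n+1) + (t - u) ^ (n+1) - 2 * t ^ (n+1)
        = t * ((t + u) ^ n + (t - u) ^ n - 2 * t ^ n) + u * ((t + u) ^ n - (t - u) ^ n) := by ring
    have e2 : (t + u) ^ (n+1) - (t - u) ^ (n+1)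
        = t * ((t + u) ^ n - (t - u) ^ n) + u * ((t + u) ^ n + (t - u) ^ n - 2 * t ^ n)
          + 2 * u * t ^ n := by ring
    have e3 : (1 + u) ^ (n+1) + (1 - u) ^ (n+1) - 2
        = ((1 + u) ^ n + (1 - u) ^ n - 2) + u * ((1 + u) ^ n - (1 - u) ^ n) := by ring
    have e4 : (1 + u) ^ (n+1) - (1 - u) ^ (n+1)
        = ((1 + u) ^ n - (1 - u) ^ n) + u * ((1 + u) ^ n + (1 - u) ^ n - 2)
          + 2 * u * 1 := by ring
    rw [e1, e2, e3, e4]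
    have h5 : t ^ n ≤ 1 := pow_le_one₀ ht ht1
    have h6 : 0 ≤ t ^ n := by positivity
    refine ⟨⟨by positivity, by positivity⟩, ?_, ?_⟩
    · have := mul_le_of_le_one_left h1 ht1
      have := mul_le_mul_of_nonneg_left h4 hu
      linarith
    · have := mul_le_of_le_one_left h2 ht1
      have := mul_le_mul_of_nonneg_left h3 hu
      have := mul_le_mul_of_nonneg_left h5 (by positivity : 0 ≤ 2 * u)
      linarith

theorem aux_X (k : ℕ) (t u : ℝ) (ht : 0 ≤ t) (ht1 : t ≤ 1) :
    (t + u) ^ k + (t - u) ^ k - 2 * t ^ k ≤ (1 + u) ^ k + (1 - u) ^ k - 2 := by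
  rcases le_total 0 u with h | h
  · exact (aux_XD k t u ht ht1 h).2.1
  · have := (aux_XD k t (-u) ht ht1 (by linarith)).2.1
    simp only [sub_neg_eq_add, ← sub_eq_add_neg] at this
    linarith

theorem aux_mid (k : ℕ) (a b : ℝ) (ha : 0 ≤ a) (hb : 0 ≤ b) :
    2 * ((a + b) / 2) ^ k ≤ a ^ k + b ^ k := by
  have hcv : ConvexOn ℝ (Set.Ici 0) fun x : ℝ => x ^ k := convexOn_pow k
  have h := hcv.2 (Set.mem_Ici.2 ha) (Set.mem_Ici.2 hb) (by norm_num : (0:ℝ) ≤ 1/2)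
    (by norm_num : (0:ℝ) ≤ 1/2) (by norm_num)
  simp only [smul_eq_mul] at h
  have e : (a + b) / 2 = 1 / 2 * a + 1 / 2 * b := by ring
  rw [e]; linarith

/-- upper bound of `p` -/
theorem aux_p_le (k : ℕ) (a b c d : ℝ) (ha : 0 ≤ a) (hb : 0 ≤ b) (hc : 0 ≤ c) (hd : 0 ≤ d)
    (hs : a + b + c + d = 1) :
    1 - (a + b) ^ k - (c + d) ^ k - (a + c) ^ k - (b + d) ^ k + a ^ k + b ^ k + c ^ k + d ^ k
     ≤ 1 - 2 * (2 * (1 / 2) ^ k) + (2 * (1 / 2) ^ k) * ((a + d) ^ k + (b + c) ^ k) := by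
  have sc : ∀ y : ℝ, y ^ k = (1 / 2) ^ k * (2 * y) ^ k := by
    intro y; rw [← mul_pow]; congr 1; ring
  have h1 := aux_X k (a + d) (a - d) (by linarith) (by linarith)
  have h2 := aux_X k (b + c) (b - c) (by linarith) (by linarith)
  have g1 := aux_mid k (2 * (a + b)) (2 * (a + c)) (by linarith) (by linarith)
  have g2 := aux_mid k (2 * (c + d)) (2 * (b + d)) (by linarith) (by linarith)
  have g3 := aux_mid k (2 * (a + b)) (2 * (b + d)) (by linarith) (by linarith)
  have g4 := aux_mid k (2 * (c + d)) (2 * (a + c)) (by linarith) (by linarith)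
  rw [show (2 * (a + b) + 2 * (a + c)) / 2 = 1 + (a - d) by linarith] at g1
  rw [show (2 * (c + d) + 2 * (b + d)) / 2 = 1 - (a - d) by linarith] at g2
  rw [show (2 * (a + b) + 2 * (b + d)) / 2 = 1 + (b - c) by linarith] at g3
  rw [show (2 * (c + d) + 2 * (a + c)) / 2 = 1 - (b - c) by linarith] at g4
  rw [show a + d + (a - d) = 2 * a by ring, show a + d - (a - d) = 2 * d by ring] at h1
  rw [show b + c + (b - c) = 2 * b by ring, show b + c - (b - c) = 2 * c by ring] at h2
  rw [sc (a+b), sc (c+d), sc (a+c), sc (b+d), sc a, sc b, sc c, sc d]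
  have hp : (0:ℝ) ≤ (1 / 2) ^ k := by positivity
  have key : (2 * a) ^ k + (2 * b) ^ k + (2 * c) ^ k + (2 * d) ^ k + 4
      ≤ (2 * (a + b)) ^ k + (2 * (c + d)) ^ k + (2 * (a + c)) ^ k + (2 * (b + d)) ^ k
      + 2 * (a + d) ^ k + 2 * (b + c) ^ k := by linarith
  have := mul_le_mul_of_nonneg_left key hp
  linarith

theorem aux_super (k : ℕ) (a b : ℝ) (ha : 0 ≤ a) (hb : 0 ≤ b) :
    a ^ (k+1) + b ^ (k+1) ≤ (a + b) ^ (k+1) := by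
  have h1 : a ^ k ≤ (a + b) ^ k := pow_le_pow_left₀ ha (by linarith) k
  have h2 : b ^ k ≤ (a + b) ^ k := pow_le_pow_left₀ hb (by linarith) k
  have := mul_le_mul_of_nonneg_left h1 ha
  have := mul_le_mul_of_nonneg_left h2 hb
  have e : (a + b) ^ (k+1) = a * (a + b) ^ k + b * (a + b) ^ k := by ring
  rw [e, pow_succ', pow_succ']; linarith

theorem aux_p_nonneg (k : ℕ) (a b c d : ℝ) (ha : 0 ≤ a) (hb : 0 ≤ b) (hc : 0 ≤ c) (hd : 0 ≤ d)
    (hs : a + b + c + d = 1) :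
    0 ≤ 1 - (a + b) ^ (k+1) - (c + d) ^ (k+1) - (a + c) ^ (k+1) - (b + d) ^ (k+1)
      + a ^ (k+1) + b ^ (k+1) + c ^ (k+1) + d ^ (k+1) := by
  induction k with
  | zero => simp only [zero_add, pow_one]; linarith
  | succ n ih =>
    have h1 := mul_le_mul_of_nonneg_right (aux_super n a b ha hb) (by linarith : 0 ≤ c + d)
    have h2 := mul_le_mul_of_nonneg_right (aux_super n c d hc hd) (by linarith : 0 ≤ a + b)
    have h3 := mul_le_mul_of_nonneg_right (aux_super n a c ha hc) (by linarith : 0 ≤ b + d)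
    have h4 := mul_le_mul_of_nonneg_right (aux_super n b d hb hd) (by linarith : 0 ≤ a + c)
    have s1 : ∀ y z : ℝ, y + z = 1 → y ^ (n+1+1) = y ^ (n+1) - y ^ (n+1) * z := by
      intro y z h; rw [pow_succ y (n+1), show y = 1 - z by linarith]; ring
    rw [s1 (a+b) (c+d) (by linarith), s1 (c+d) (a+b) (by linarith), s1 (a+c) (b+d) (by linarith),
      s1 (b+d) (a+c) (by linarith), s1 a (b+c+d) (by linarith), s1 b (a+c+d) (by linarith),
      s1 c (a+b+d) (by linarith), s1 d (a+b+c) (by linarith)]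
    have p1 : 0 ≤ a ^ (n+1) * d := by positivity
    have p2 : 0 ≤ b ^ (n+1) * c := by positivity
    have p3 : 0 ≤ c ^ (n+1) * b := by positivity
    have p4 : 0 ≤ d ^ (n+1) * a := by positivity
    nlinarith

theorem aux_ent2 (a d : ℝ) (ha : 0 ≤ a) (hd : 0 ≤ d) :
    negMulLog a + negMulLog d ≤ negMulLog (a + d) + (a + d) * log 2 := by
  have h := concaveOn_negMulLog.2 (Set.mem_Ici.2 ha) (Set.mem_Ici.2 hd) (by norm_num : (0:ℝ) ≤ 1/2)
    (by norm_num : (0:ℝ) ≤ 1/2) (by norm_num)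
  simp only [smul_eq_mul] at h
  rcases eq_or_lt_of_le (add_nonneg ha hd) with h0 | h0
  · have : a = 0 := by linarith
    have : d = 0 := by linarith
    subst_vars; simp
  · have e : 1 / 2 * a + 1 / 2 * d = (a + d) / 2 := by ring
    rw [e] at h
    have : negMulLog ((a + d) / 2) = (negMulLog (a + d) + (a + d) * log 2) / 2 := by
      unfold negMulLog
      rw [log_div h0.ne' (by norm_num)]; ring
    linarith

theorem aux_gibbs (z : ℝ) (hz : 0 ≤ z) : negMulLog z ≤ z * log 4 + 1 / 4 - z ∧
    (z ≠ 1 / 4 → negMulLog z < z * log 4 + 1 / 4 - z) := by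
  rcases eq_or_lt_of_le hz with h | h
  · subst h; simp
  · have e : z * log 4 - negMulLog z = - (z * log (1 / (4 * z))) := by
      unfold negMulLog
      rw [one_div, log_inv, log_mul (by norm_num) h.ne']; ring
    have e2 : z * (1 / (4 * z) - 1) = 1 / 4 - z := by field_simp
    have hp : 0 < 1 / (4 * z) := by positivity
    constructor
    · have := mul_le_mul_of_nonneg_left (log_le_sub_one_of_pos hp) h.le
      linarith
    · intro hne
      have : 1 / (4 * z) ≠ 1 := by
        intro h1; apply hne; field_simp at h1; linarith
      have := mul_lt_mul_of_pos_left (log_lt_sub_one_of_pos hp this) h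
      linarith

theorem aux_gibbs4 (a b c d : ℝ) (ha : 0 ≤ a) (hb : 0 ≤ b) (hc : 0 ≤ c) (hd : 0 ≤ d)
    (hs : a + b + c + d = 1) (hne : ¬ (a = 1/4 ∧ b = 1/4 ∧ c = 1/4)) :
    negMulLog a + negMulLog b + negMulLog c + negMulLog d < log 4 := by
  have e : log 4 = a * log 4 + b * log 4 + c * log 4 + d * log 4 := by
    rw [← add_mul, ← add_mul, ← add_mul, hs, one_mul]
  have h1 := aux_gibbs a ha
  have h2 := aux_gibbs b hb
  have h3 := aux_gibbs c hc
  have h4 := aux_gibbs d hd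
  by_cases ca : a = 1/4
  · by_cases cb : b = 1/4
    · have cc : c ≠ 1/4 := fun h => hne ⟨ca, cb, h⟩
      have := h3.2 cc
      linarith
    · have := h2.2 cb
      linarith
  · have := h1.2 ca
    linarith

theorem aux_pinsker1 (z : ℝ) (hz : 0 ≤ z) (hz2 : z ≤ 2) :
    (z - 1) + (z - 1) ^ 2 / 6 ≤ z * log z := by
  obtain ⟨w, hw, rfl⟩ : ∃ w : ℝ, 0 ≤ w ∧ z = w ^ 2 := ⟨√z, sqrt_nonneg z, (sq_sqrt hz).symm⟩
  have hw2 : w ≤ 1.42 := by nlinarith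
  have h1 : 2 * w ^ 2 - 2 * w ≤ w ^ 2 * log (w ^ 2) := by
    rcases eq_or_lt_of_le hw with h | h
    · subst h; simp
    · have := mul_le_mul_of_nonneg_left (one_sub_inv_le_log_of_pos h) (by positivity : 0 ≤ 2 * w ^ 2)
      have e : 2 * w ^ 2 * (1 - w⁻¹) = 2 * w ^ 2 - 2 * w := by field_simp
      rw [log_pow]; push_cast; linarith
  have h2 : (w + 1) ^ 2 ≤ 6 := by nlinarith
  have := mul_le_mul_of_nonneg_left h2 (sq_nonneg (w - 1))
  nlinarith

theorem aux_pinsker (t s : ℝ) (ht : 0 ≤ t) (hs : 0 ≤ s) (hts : t + s = 1) :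
    negMulLog t + negMulLog s ≤ log 2 - (t - s) ^ 2 / 6 := by
  have h1 := aux_pinsker1 (2 * t) (by linarith) (by linarith)
  have h2 := aux_pinsker1 (2 * s) (by linarith) (by linarith)
  have e : ∀ y : ℝ, 0 ≤ y → 2 * y * log (2 * y) = 2 * (y * log 2 - negMulLog y) := by
    intro y hy
    rcases eq_or_lt_of_le hy with h | h
    · subst h; simp
    · unfold negMulLog; rw [log_mul (by norm_num) h.ne']; ring
  rw [e t ht] at h1
  rw [e s hs] at h2
  have : log 2 = t * log 2 + s * log 2 := by rw [← add_mul, hts, one_mul]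
  have e1 : 2 * t - 1 = t - s := by linarith
  have e2 : 2 * s - 1 = -(t - s) := by linarith
  rw [e1] at h1; rw [e2] at h2
  nlinarith

theorem aux_near (k : ℕ) (y : ℝ) (hy : 0 ≤ y) (hy1 : y ≤ 1) :
    (1 + y) ^ k + (1 - y) ^ k - 2 ≤ k ^ 2 * y ^ 2 * (1 + y) ^ k ∧
    (1 + y) ^ k - (1 - y) ^ k ≤ 2 * k * y * (1 + y) ^ k := by
  induction k with
  | zero => norm_num
  | succ n ih =>
    obtain ⟨h1, h2⟩ := ih
    have p1 : (1:ℝ) ≤ (1 + y) ^ n := one_le_pow₀ (by linarith)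
    have p2 : (1 - y) ^ n ≤ (1 + y) ^ n := pow_le_pow_left₀ (by linarith) (by linarith) n
    have e1 : (1 + y) ^ (n+1) + (1 - y) ^ (n+1) - 2
        = ((1 + y) ^ n + (1 - y) ^ n - 2) + y * ((1 + y) ^ n - (1 - y) ^ n) := by ring
    have e2 : (1 + y) ^ (n+1) - (1 - y) ^ (n+1)
        = ((1 + y) ^ n - (1 - y) ^ n) + y * ((1 + y) ^ n + (1 - y) ^ n) := by ring
    rw [e1, e2]
    have m : (1 + y) ^ n ≤ (1 + y) ^ (n+1) := pow_le_pow_right₀ (by linarith) (by omega)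
    have q1 := mul_le_mul_of_nonneg_left h2 hy
    have q2 := mul_le_mul_of_nonneg_left p2 hy
    push_cast
    constructor
    · have := mul_le_mul_of_nonneg_left m (by positivity : 0 ≤ ((n:ℝ)+1)^2 * y ^ 2)
      have : 0 ≤ y ^ 2 * (1 + y) ^ n := by positivity
      nlinarith
    · have := mul_le_mul_of_nonneg_left m (by positivity : 0 ≤ 2 * ((n:ℝ)+1) * y)
      nlinarith

/-- case of t bounded away from 1 -/
theorem aux_case1 (k : ℕ) (x q R t s : ℝ) (hx : x = 2 * (1 / 2) ^ k) (hq : q = 1 - x)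
    (hx4 : x ≤ 1 / 4) (hR : 0 ≤ R) (hRx : R * x ≤ 1) (hts : t + s = 1)
    (hs1 : 1 / 20 ≤ s) (hst : s < t) (hk : 4 * (k:ℝ) ^ 2 * (19 / 20) ^ k < 1 / 6) :
    R * log ((1 - 2 * x + x * (t ^ k + s ^ k)) / q ^ 2) + (negMulLog t + negMulLog s) - log 2 < 0 := by
  have hx0 : 0 < x := by rw [hx]; positivity
  have hp := aux_pinsker t s (by linarith) (by linarith) hts
  have hn := (aux_near k (t - s) (by linarith) (by linarith)).1
  have hq4 : 1 / 4 ≤ q ^ 2 := by rw [hq]; nlinarith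
  have e1 : 1 + (t - s) = 2 * t := by linarith
  have e2 : 1 - (t - s) = 2 * s := by linarith
  rw [e1, e2] at hn
  have hpk : (0:ℝ) < (1 / 2) ^ k := by positivity
  have sc : ∀ y : ℝ, y ^ k = (1 / 2) ^ k * (2 * y) ^ k := by
    intro y; rw [← mul_pow]; congr 1; ring
  have hn2 : t ^ k + s ^ k - x ≤ k ^ 2 * (t - s) ^ 2 * t ^ k := by
    have := mul_le_mul_of_nonneg_left hn hpk.le
    rw [sc t, sc s, hx]; linarith
  have htk : t ^ k ≤ (19 / 20) ^ k := pow_le_pow_left₀ (by linarith) (by linarith) k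
  have hd : 0 < (t - s) ^ 2 := by have : 0 < t - s := by linarith
                                  positivity
  have hn3 : t ^ k + s ^ k - x ≤ k ^ 2 * (t - s) ^ 2 * (19 / 20) ^ k :=
    hn2.trans (mul_le_mul_of_nonneg_left htk (by positivity))
  have hst0 : 0 < t ^ k := pow_pos (by linarith) k
  have hss0 : 0 < s ^ k := pow_pos (by linarith) k
  have hq0 : 0 < q ^ 2 := by linarith
  have hP : 0 < (1 - 2 * x + x * (t ^ k + s ^ k)) / q ^ 2 := by
    apply div_pos _ hq0
    have : 0 < x * (t ^ k + s ^ k) := by positivity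
    linarith
  have hl := log_le_sub_one_of_pos hP
  have e3 : (1 - 2 * x + x * (t ^ k + s ^ k)) / q ^ 2 - 1 = x * (t ^ k + s ^ k - x) / q ^ 2 := by
    rw [eq_div_iff hq0.ne', sub_mul, div_mul_cancel₀ _ hq0.ne', hq]; ring
  rw [e3] at hl
  set W := k ^ 2 * (t - s) ^ 2 * (19 / 20 : ℝ) ^ k with hW
  have hW0 : 0 ≤ W := by positivity
  have h5 : x * (t ^ k + s ^ k - x) / q ^ 2 ≤ x * W * 4 := by
    rw [div_le_iff₀ hq0]
    have a1 : x * (t ^ k + s ^ k - x) ≤ x * W := mul_le_mul_of_nonneg_left hn3 hx0.le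
    have a2 : 0 ≤ x * W := by positivity
    nlinarith
  have h6 : R * log ((1 - 2 * x + x * (t ^ k + s ^ k)) / q ^ 2) ≤ R * (x * W * 4) :=
    mul_le_mul_of_nonneg_left (hl.trans h5) hR
  have h7 : R * (x * W * 4) ≤ W * 4 := by
    have := mul_le_mul_of_nonneg_right hRx (by positivity : 0 ≤ W * 4)
    linarith
  have h8 : W * 4 < (t - s) ^ 2 / 6 := by
    have := mul_lt_mul_of_pos_right hk hd
    rw [hW]; linarith
  linarith

theorem aux_bern1 (k : ℕ) (s : ℝ) (h0 : 0 ≤ s) (h1 : s ≤ 1) :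
    (1 - s) ^ k ≤ 1 - k * s + k ^ 2 * s ^ 2 := by
  induction k with
  | zero => norm_num
  | succ n ih =>
    rw [pow_succ]
    have := mul_le_mul_of_nonneg_right ih (by linarith : 0 ≤ 1 - s)
    push_cast
    have : 0 ≤ (n:ℝ) ^ 2 * s ^ 3 := by positivity
    have : 0 ≤ (n:ℝ) * s ^ 2 := by positivity
    have : 0 ≤ s ^ 2 := by positivity
    nlinarith

theorem aux_bern2 (k : ℕ) (s : ℝ) (h0 : 0 ≤ s) (h1 : s ≤ 1) :
    (1 - s) ^ k * (1 + k * s) ≤ 1 := by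
  have h := one_add_mul_le_pow (a := s) (by linarith) k
  have hp : 0 ≤ (1 - s) ^ k := pow_nonneg (by linarith) k
  have h2 := mul_le_mul_of_nonneg_left h hp
  rw [← mul_pow] at h2
  have : ((1 - s) * (1 + s)) ^ k ≤ 1 := pow_le_one₀ (by nlinarith) (by nlinarith)
  linarith

theorem aux_neglog (x : ℝ) (h0 : 0 ≤ x) (h1 : x ≤ 1 / 4) :
    - log (1 - x) ≤ x + x ^ 2 / 2 + 4 / 3 * x ^ 3 := by
  have h := abs_log_sub_add_sum_range_le (x := x) (by rw [abs_of_nonneg h0]; linarith) 2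
  rw [abs_of_nonneg h0] at h
  have h2 := (abs_le.1 h).1
  simp only [Finset.sum_range_succ, Finset.sum_range_zero] at h2
  norm_num at h2
  have : x ^ 3 / (1 - x) ≤ x ^ 3 * (4/3) := by
    rw [div_le_iff₀ (by linarith)]
    have : 0 ≤ x ^ 3 := by positivity
    nlinarith
  linarith

set_option maxHeartbeats 1000000 in
/-- case of t near 1 -/
theorem aux_case2 (k : ℕ) (x q R ε c t s : ℝ) (hε : 0 < ε) (hk2 : 2 ≤ k)
    (hx : x = 2 * (1 / 2) ^ k) (hq : q = 1 - x)
    (hc : c = (log 2 + 1 + ε) / 2)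
    (hx4 : x ≤ 1 / 4) (hR : 0 ≤ R) (hRx : R * x = log 2 - c * x) (hts : t + s = 1)
    (hs0 : 0 ≤ s) (hs1 : s ≤ 1 / 20)
    (hC2 : c * x ≤ log 2 - 1 / 2)
    (hC3 : exp (c * x * k + 2 / k) - 1 - ε + 2 * x < 0)
    (hC4 : 4 + 6 * log k < k / 2) :
    R * log ((1 - 2 * x + x * (t ^ k + s ^ k)) / q ^ 2) + (negMulLog t + negMulLog s) - log 2 < 0 := by
  have hx0 : 0 < x := by rw [hx]; positivity
  have hq0 : 0 < q := by linarith
  have hq1 : q ≤ 1 := by linarith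
  have ht : t = 1 - s := by linarith
  have ht0 : 0 < t := by linarith
  have hl2 : log 2 ≤ 1 := by have := log_two_lt_d9; linarith
  have hl2' : 0 < log 2 := log_pos (by norm_num)
  have hc0 : 0 < c := by rw [hc]; positivity
  have hk0 : (0:ℝ) < k := by have : 0 < k := by omega
                             exact_mod_cast this
  set L := 1 - t ^ k - s ^ k with hL
  have htk0 : 0 < t ^ k := pow_pos ht0 k
  have hsk0 : 0 ≤ s ^ k := pow_nonneg hs0 k
  have hL0 : 0 ≤ L := by
    have h1 : t ^ k ≤ t := pow_le_of_le_one ht0.le (by linarith) (by omega)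
    have h2 : s ^ k ≤ s := pow_le_of_le_one hs0 (by linarith) (by omega)
    linarith
  have eP : 1 - 2 * x + x * (t ^ k + s ^ k) = q - x * L := by rw [hL, hq]; ring
  have hP0 : 0 < q - x * L := by
    rw [← eP]
    have : 0 < x * (t ^ k + s ^ k) := by positivity
    linarith
  have hlogP : log (q - x * L) ≤ log q - x * L := by
    have h1 : q - x * L = q * ((q - x * L) / q) := by field_simp
    have hp : 0 < (q - x * L) / q := div_pos hP0 hq0
    rw [h1, log_mul hq0.ne' hp.ne']
    have h2 := log_le_sub_one_of_pos hp
    have h3 : (q - x * L) / q - 1 = - (x * L / q) := by field_simp; ring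
    have h4 : x * L ≤ x * L / q := by
      rw [le_div_iff₀ hq0]
      have : 0 ≤ x * L := by positivity
      nlinarith
    linarith
  have hlog : log ((1 - 2 * x + x * (t ^ k + s ^ k)) / q ^ 2) ≤ - log q - x * L := by
    rw [eP, log_div hP0.ne' (by positivity), log_pow]; push_cast; linarith
  have hnl := aux_neglog x hx0.le hx4
  rw [← hq] at hnl
  have h1 : R * log ((1 - 2 * x + x * (t ^ k + s ^ k)) / q ^ 2) ≤
      R * (x + x ^ 2 / 2 + 4 / 3 * x ^ 3) - R * x * L := by
    have := mul_le_mul_of_nonneg_left (hlog.trans (by linarith :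
      - log q - x * L ≤ x + x ^ 2 / 2 + 4 / 3 * x ^ 3 - x * L)) hR
    linarith
  have h2 : R * (x + x ^ 2 / 2 + 4 / 3 * x ^ 3) ≤ log 2 - x * (1 + ε) / 2 + x ^ 2 := by
    have e : R * (x + x ^ 2 / 2 + 4 / 3 * x ^ 3) = (log 2 - c * x) * (1 + x / 2 + 4 / 3 * x ^ 2) := by
      rw [← hRx]; ring
    rw [e]
    have e2 : c * x = log 2 * x / 2 + x * (1 + ε) / 2 := by rw [hc]; ring
    have p1 : 0 ≤ c * x * (x / 2 + 4 / 3 * x ^ 2) := by positivity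
    have p2 : 4 / 3 * log 2 * x ^ 2 ≤ x ^ 2 := by
      have := log_two_lt_d9
      have : 0 ≤ x ^ 2 := by positivity
      nlinarith
    linarith
  have ht' : negMulLog t ≤ s := by
    have := mul_le_mul_of_nonneg_left (one_sub_inv_le_log_of_pos ht0) ht0.le
    have e : t * (1 - t⁻¹) = t - 1 := by field_simp
    unfold negMulLog; linarith
  rw [hRx] at h1
  have main : R * log ((1 - 2 * x + x * (t ^ k + s ^ k)) / q ^ 2) + (negMulLog t + negMulLog s)
      - log 2 ≤ - x * (1 + ε) / 2 + x ^ 2 - (log 2 - c * x) * L + s + negMulLog s := by linarith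
  refine lt_of_le_of_lt main ?_
  rcases le_total (s * k ^ 3) 1 with hcase | hcase
  · -- tiny s
    have b1 := aux_bern1 k s hs0 (by linarith)
    rw [← ht] at b1
    have hk3 : k ^ 2 * s ^ 2 ≤ s / k := by
      rw [le_div_iff₀ hk0]
      have := mul_le_mul_of_nonneg_left hcase hs0
      linarith
    have hss : s ^ k ≤ s / k := by
      have a1 : s ^ k ≤ s ^ 2 := pow_le_pow_of_le_one hs0 (by linarith) hk2
      have a2 : s ^ 2 ≤ k ^ 2 * s ^ 2 := by
        have : (1:ℝ) ≤ (k:ℝ) ^ 2 := one_le_pow₀ (by exact_mod_cast (by omega : 1 ≤ k))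
        have : 0 ≤ s ^ 2 := by positivity
        nlinarith
      linarith
    have hLb : k * s - 2 * (s / k) ≤ L := by linarith
    have hLm := mul_le_mul_of_nonneg_left hLb (by linarith : 0 ≤ log 2 - c * x)
    have hsk : 0 ≤ s / k := by positivity
    set η := c * x * k + 2 / k with hη
    have hmul : (log 2) * k * s - η * s ≤ (log 2 - c * x) * L := by
      have p1 : 0 ≤ c * x * (s / k) := by positivity
      have p2 : log 2 * (s / k) ≤ s / k := by nlinarith
      have e : η * s = c * x * k * s + 2 * (s / k) := by rw [hη]; ring
      nlinarith
    set m := x / 2 * exp η with hm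
    have hm0 : 0 < m := by positivity
    have hlm : log m = - k * log 2 + η := by
      rw [hm, log_mul (by positivity) (exp_pos _).ne', log_exp, hx,
        show (2 * (1 / 2 : ℝ) ^ k / 2) = (2 ^ k)⁻¹ by rw [one_div, inv_pow]; ring,
        log_inv, log_pow]; ring
    have hs' : s + s * log m + negMulLog s ≤ m := by
      rcases eq_or_lt_of_le hs0 with h | h
      · rw [← h]; simp; exact hm0.le
      · have := mul_le_mul_of_nonneg_left (log_le_sub_one_of_pos (div_pos hm0 h)) h.le
        rw [log_div hm0.ne' h.ne'] at this
        have e : s * (m / s - 1) = m - s := by field_simp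
        unfold negMulLog; linarith
    rw [hlm] at hs'
    have : m < x / 2 * (1 + ε - 2 * x) := by
      rw [hm]; apply mul_lt_mul_of_pos_left _ (by linarith); linarith
    linarith
  · -- moderate s
    have hs00 : 0 < s := by
      rcases eq_or_lt_of_le hs0 with h | h
      · rw [← h] at hcase; norm_num at hcase
      · exact h
    have b2 := aux_bern2 k s hs0 (by linarith)
    rw [← ht] at b2
    have hss : s ^ k ≤ s := pow_le_of_le_one hs0 (by linarith) (by omega)
    have hlogs : - log s ≤ 3 * log k := by
      have : 0 ≤ log (s * k ^ 3) := log_nonneg hcase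
      rw [log_mul hs00.ne' (by positivity), log_pow] at this
      push_cast at this; linarith
    set Λ := 4 - 2 * log s with hΛ
    have hΛk : Λ < k / 2 := by linarith
    have hsΛ : s * Λ ≤ 1 / 2 := by
      have h20 : log (1 / (20 * s)) ≤ 1 / (20 * s) - 1 := log_le_sub_one_of_pos (by positivity)
      rw [one_div, log_inv, log_mul (by norm_num) hs00.ne'] at h20
      have hl20 : log 20 ≤ 3 := by
        rw [log_le_iff_le_exp (by norm_num)]
        have h1 : exp 3 = exp 1 ^ 3 := by rw [← exp_nat_mul]; norm_num
        have h2 := exp_one_gt_d9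
        have h3 : (2.7182818283:ℝ) ^ 3 ≤ exp 1 ^ 3 := pow_le_pow_left₀ (by norm_num) h2.le 3
        rw [h1]; refine le_trans ?_ h3; norm_num
      have := mul_le_mul_of_nonneg_left h20 hs0
      have e : s * ((20 * s)⁻¹ - 1) = 1 / 20 - s := by field_simp
      rw [hΛ]
      nlinarith
    have hLs : s * Λ ≤ L + s := by
      have a1 : (1 - t ^ k) * (1 + k * s) ≥ k * s := by linarith
      have a2 : s * Λ * (1 + k * s) ≤ k * s := by
        have e : s * Λ * (1 + k * s) = s * Λ + (s * Λ) * (k * s) := by ring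
        have : (s * Λ) * (k * s) ≤ 1 / 2 * (k * s) :=
          mul_le_mul_of_nonneg_right hsΛ (by positivity)
        have : s * Λ ≤ s * (k / 2) := mul_le_mul_of_nonneg_left hΛk.le hs0
        linarith
      have a3 : s * Λ ≤ 1 - t ^ k := le_of_mul_le_mul_right (a2.trans a1) (by positivity)
      linarith
    have hLm := mul_le_mul_of_nonneg_right (by linarith : 1 / 2 ≤ log 2 - c * x) hL0
    have e : negMulLog s = s * (Λ / 2 - 2) := by unfold negMulLog; rw [hΛ]; ring
    rw [e]
    have : 0 < x * ε := by positivity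
    have : x * x ≤ 1 / 4 * x := mul_le_mul_of_nonneg_right hx4 hx0.le
    linarith

theorem aux_two_rpow (k : ℕ) : (2:ℝ) ^ (1 - (k:ℝ)) = 2 * (1 / 2) ^ k := by
  rw [rpow_sub (by norm_num), rpow_one, rpow_natCast, one_div, inv_pow]; rfl

theorem aux_self_rpow (z : ℝ) (hz : 0 ≤ z) : z ^ z = exp (- negMulLog z) := by
  rcases eq_or_lt_of_le hz with h | h
  · subst h; simp
  · rw [rpow_def_of_pos h]; unfold negMulLog; congr 1; ring

theorem aux_hypG_eq (k : ℕ) (r α β γ : ℝ) (h1 : 0 ≤ γ) (h2 : γ ≤ α) (h3 : γ ≤ β)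
    (h4 : α + β - γ ≤ 1) :
    hypG k r α β γ = (hypP k α β γ / (1 - 2 * (1 / 2) ^ k) ^ 2) ^ r *
      exp (negMulLog γ + negMulLog (α - γ) + negMulLog (β - γ) + negMulLog (1 - α - β + γ)
        - log 4) := by
  unfold hypG
  rw [aux_two_rpow, aux_self_rpow γ h1, aux_self_rpow (α - γ) (by linarith),
    aux_self_rpow (β - γ) (by linarith), aux_self_rpow (1 - α - β + γ) (by linarith), div_eq_mul_inv]
  congr 1
  rw [exp_sub, exp_log (by norm_num), exp_add, exp_add, exp_add]
  simp only [exp_neg]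
  field_simp

theorem aux_params (ε : ℝ) (hε : 0 < ε) : ∃ k₀ : ℕ, ∀ k : ℕ, k₀ ≤ k →
    2 ≤ k ∧ (2 * (1 / 2 : ℝ) ^ k ≤ 1 / 4) ∧
    (4 * (k:ℝ) ^ 2 * (19 / 20) ^ k < 1 / 6) ∧
    ((log 2 + 1 + ε) / 2 * (2 * (1 / 2 : ℝ) ^ k) ≤ log 2 - 1 / 2) ∧
    (exp ((log 2 + 1 + ε) / 2 * (2 * (1 / 2 : ℝ) ^ k) * k + 2 / k) - 1 - ε
      + 2 * (2 * (1 / 2 : ℝ) ^ k) < 0) ∧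
    (4 + 6 * log k < (k:ℝ) / 2) ∧ ((k:ℝ) ^ 2 * (1 / 2) ^ k < 1 / 128) := by
  have t1 : Filter.Tendsto (fun k : ℕ => (1 / 2 : ℝ) ^ k) Filter.atTop (nhds 0) :=
    tendsto_pow_atTop_nhds_zero_of_lt_one (by norm_num) (by norm_num)
  have t2 : Filter.Tendsto (fun k : ℕ => (k:ℝ) * (1 / 2 : ℝ) ^ k) Filter.atTop (nhds 0) :=
    tendsto_self_mul_const_pow_of_lt_one (by norm_num) (by norm_num)
  have t3 : Filter.Tendsto (fun k : ℕ => (k:ℝ) ^ 2 * (1 / 2 : ℝ) ^ k) Filter.atTop (nhds 0) :=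
    tendsto_pow_const_mul_const_pow_of_lt_one 2 (by norm_num) (by norm_num)
  have t4 : Filter.Tendsto (fun k : ℕ => (k:ℝ) ^ 2 * (19 / 20 : ℝ) ^ k) Filter.atTop (nhds 0) :=
    tendsto_pow_const_mul_const_pow_of_lt_one 2 (by norm_num) (by norm_num)
  have t5 : Filter.Tendsto (fun k : ℕ => (2:ℝ) / k) Filter.atTop (nhds 0) :=
    tendsto_const_div_atTop_nhds_zero_nat 2
  have t6 : Filter.Tendsto (fun k : ℕ => exp ((log 2 + 1 + ε) * ((k:ℝ) * (1 / 2 : ℝ) ^ k) + 2 / k)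
      - 1 - ε + 4 * (1 / 2 : ℝ) ^ k) Filter.atTop (nhds (exp ((log 2 + 1 + ε) * 0 + 0)
      - 1 - ε + 4 * 0)) := by
    refine Filter.Tendsto.add (((Filter.Tendsto.rexp ?_).sub_const _).sub_const _) (t1.const_mul _)
    exact (t2.const_mul _).add t5
  have hl2 := log_two_gt_d9
  have e1 : ∀ᶠ k : ℕ in Filter.atTop, 2 ≤ k := Filter.eventually_ge_atTop 2
  have e2 : ∀ᶠ k : ℕ in Filter.atTop, (1 / 2 : ℝ) ^ k < 1 / 8 := t1.eventually_lt_const (by norm_num)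
  have e3 : ∀ᶠ k : ℕ in Filter.atTop, (k:ℝ) ^ 2 * (19 / 20 : ℝ) ^ k < 1 / 24 :=
    t4.eventually_lt_const (by norm_num)
  have e4 : ∀ᶠ k : ℕ in Filter.atTop, (1 / 2 : ℝ) ^ k < (log 2 - 1 / 2) / (log 2 + 1 + ε) :=
    t1.eventually_lt_const (div_pos (by linarith) (by linarith))
  have e5 := t6.eventually_lt_const (u := 0) (by simp; linarith)
  have e6 : ∀ᶠ k : ℕ in Filter.atTop, ‖log (k:ℝ)‖ ≤ 1 / 24 * ‖(k:ℝ)‖ :=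
    tendsto_natCast_atTop_atTop.eventually
      (isLittleO_log_id_atTop.def (by norm_num : (0:ℝ) < 1 / 24))
  have e7 : ∀ᶠ k : ℕ in Filter.atTop, (k:ℝ) ^ 2 * (1 / 2 : ℝ) ^ k < 1 / 128 :=
    t3.eventually_lt_const (by norm_num)
  have e8 : ∀ᶠ k : ℕ in Filter.atTop, 20 ≤ k := Filter.eventually_ge_atTop 20
  obtain ⟨k₀, hk₀⟩ := Filter.eventually_atTop.1
    (e1.and (e2.and (e3.and (e4.and (e5.and (e6.and (e7.and e8)))))))
  refine ⟨k₀, fun k hk => ?_⟩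
  obtain ⟨f1, f2, f3, f4, f5, f6, f7, f8⟩ := hk₀ k hk
  refine ⟨f1, by linarith, by linarith, ?_, ?_, ?_, f7⟩
  · rw [lt_div_iff₀ (by linarith)] at f4; linarith
  · have e : (log 2 + 1 + ε) / 2 * (2 * (1 / 2 : ℝ) ^ k) * k =
      (log 2 + 1 + ε) * ((k:ℝ) * (1 / 2 : ℝ) ^ k) := by ring
    rw [e]; linarith
  · have f8' : (20:ℝ) ≤ k := by exact_mod_cast f8
    rw [Real.norm_eq_abs, Real.norm_eq_abs, abs_of_nonneg (by linarith : (0:ℝ) ≤ k)] at f6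
    have := le_abs_self (log (k:ℝ))
    linarith

theorem aux_f (k : ℕ) (x q R ε c t s : ℝ) (hε : 0 < ε) (hk2 : 2 ≤ k)
    (hx : x = 2 * (1 / 2) ^ k) (hq : q = 1 - x)
    (hc : c = (log 2 + 1 + ε) / 2)
    (hx4 : x ≤ 1 / 4) (hR : 0 ≤ R) (hRx : R * x = log 2 - c * x) (hts : t + s = 1)
    (hs0 : 0 ≤ s) (ht0 : 0 ≤ t) (hne : t ≠ s)
    (hC1 : 4 * (k:ℝ) ^ 2 * (19 / 20) ^ k < 1 / 6)
    (hC2 : c * x ≤ log 2 - 1 / 2)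
    (hC3 : exp (c * x * k + 2 / k) - 1 - ε + 2 * x < 0)
    (hC4 : 4 + 6 * log k < k / 2) :
    R * log ((1 - 2 * x + x * (t ^ k + s ^ k)) / q ^ 2) + (negMulLog t + negMulLog s) - log 2 < 0 := by
  have hx0 : 0 < x := by rw [hx]; positivity
  have hl2' : 0 < log 2 := log_pos (by norm_num)
  have hc0 : 0 < c := by rw [hc]; positivity
  have hRx1 : R * x ≤ 1 := by
    have := log_two_lt_d9
    have : 0 < c * x := by positivity
    linarith
  have key : ∀ t s : ℝ, t + s = 1 → 0 ≤ s → 0 ≤ t → s < t → R * log ((1 - 2 * x + x * (t ^ k + s ^ k)) / q ^ 2) + (negMulLog t + negMulLog s) - log 2 < 0 := by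
    intro t s hts hs0 ht0 hst
    rcases le_total s (1 / 20) with h | h
    · exact aux_case2 k x q R ε c t s hε hk2 hx hq hc hx4 hR hRx hts hs0 h hC2 hC3 hC4
    · exact aux_case1 k x q R t s hx hq hx4 hR hRx1 hts h hst hC1
  rcases lt_or_gt_of_ne hne with h | h
  · have := key s t (by linarith) ht0 hs0 h
    rw [add_comm (t ^ k), add_comm (negMulLog t)]; exact this
  · exact key t s hts hs0 ht0 h

theorem aux_lt_one (k : ℕ) (r ε : ℝ) (hε : 0 < ε) (hr : 0 < r)
    (hrR : r ≤ (2 : ℝ) ^ (k - 1) * Real.log 2 - Real.log 2 / 2 - (1 + ε) / 2)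
    (hk : 2 ≤ k ∧ (2 * (1 / 2 : ℝ) ^ k ≤ 1 / 4) ∧
    (4 * (k:ℝ) ^ 2 * (19 / 20) ^ k < 1 / 6) ∧
    ((log 2 + 1 + ε) / 2 * (2 * (1 / 2 : ℝ) ^ k) ≤ log 2 - 1 / 2) ∧
    (exp ((log 2 + 1 + ε) / 2 * (2 * (1 / 2 : ℝ) ^ k) * k + 2 / k) - 1 - ε
      + 2 * (2 * (1 / 2 : ℝ) ^ k) < 0) ∧
    (4 + 6 * log k < (k:ℝ) / 2) ∧ ((k:ℝ) ^ 2 * (1 / 2) ^ k < 1 / 128))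
    (α β γ : ℝ) (h1 : 0 ≤ γ) (h2 : γ ≤ α) (h3 : γ ≤ β) (h4 : α + β - γ ≤ 1)
    (hne : (α, β, γ) ≠ (1 / 2, 1 / 2, 1 / 4)) : hypG k r α β γ < 1 := by
  obtain ⟨k2, hx4, hC1, hC2, hC3, hC4, -⟩ := hk
  rw [aux_hypG_eq k r α β γ h1 h2 h3 h4]
  set R := (2 : ℝ) ^ (k - 1) * Real.log 2 - Real.log 2 / 2 - (1 + ε) / 2 with hR
  set x := 2 * (1 / 2 : ℝ) ^ k with hx
  set q := 1 - x with hq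
  set c := (log 2 + 1 + ε) / 2 with hc
  have hx0 : 0 < x := by positivity
  have hq0 : 0 < q := by linarith
  have hR0 : 0 < R := hr.trans_le hrR
  have hRx : R * x = log 2 - c * x := by
    have e : (2:ℝ) ^ (k - 1) * x = 1 := by
      obtain ⟨m, rfl⟩ : ∃ m, k = m + 1 := ⟨k - 1, by omega⟩
      rw [hx, Nat.add_sub_cancel, one_div, inv_pow, pow_succ]; field_simp
    rw [hR, hc]
    linear_combination log 2 * e
  obtain ⟨b, hb⟩ : ∃ b, b = α - γ := ⟨_, rfl⟩
  obtain ⟨c', hc'⟩ : ∃ c', c' = β - γ := ⟨_, rfl⟩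
  obtain ⟨d, hd⟩ : ∃ d, d = 1 - α - β + γ := ⟨_, rfl⟩
  have hP : hypP k α β γ = 1 - (γ + b) ^ k - (c' + d) ^ k - (γ + c') ^ k - (b + d) ^ k
      + γ ^ k + b ^ k + c' ^ k + d ^ k := by
    unfold hypP
    rw [← hb, ← hc', ← hd, show γ + b = α by linarith, show γ + c' = β by linarith,
      show c' + d = 1 - α by linarith, show b + d = 1 - β by linarith]
  rw [hP, ← hb, ← hc', ← hd]
  have hb0 : 0 ≤ b := by linarith
  have hc0 : 0 ≤ c' := by linarith
  have hd0 : 0 ≤ d := by linarith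
  have hs : γ + b + c' + d = 1 := by linarith
  have hne' : ¬ (γ = 1/4 ∧ b = 1/4 ∧ c' = 1/4) := by
    rintro ⟨g1, g2, g3⟩
    apply hne
    rw [show α = 1 / 2 by linarith, show β = 1 / 2 by linarith, g1]
  have hple := aux_p_le k γ b c' d h1 hb0 hc0 hd0 hs
  have hp0 : 0 ≤ 1 - (γ + b) ^ k - (c' + d) ^ k - (γ + c') ^ k - (b + d) ^ k
      + γ ^ k + b ^ k + c' ^ k + d ^ k := by
    obtain ⟨m, rfl⟩ : ∃ m, k = m + 1 := ⟨k - 1, by omega⟩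
    exact aux_p_nonneg m γ b c' d h1 hb0 hc0 hd0 hs
  rw [← hx] at hple
  obtain ⟨t, ht⟩ : ∃ t, t = γ + d := ⟨_, rfl⟩
  obtain ⟨s, hs'⟩ : ∃ s, s = b + c' := ⟨_, rfl⟩
  rw [← ht, ← hs'] at hple
  have hts : t + s = 1 := by linarith
  have ht0 : 0 ≤ t := by linarith
  have hs0 : 0 ≤ s := by linarith
  have hmid := aux_mid k t s ht0 hs0
  rw [hts, ← hx] at hmid
  have hge : 1 ≤ (1 - 2 * x + x * (t ^ k + s ^ k)) / q ^ 2 := by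
    rw [le_div_iff₀ (by positivity), hq]
    have := mul_le_mul_of_nonneg_left hmid hx0.le
    linarith
  have hpow : ((1 - (γ + b) ^ k - (c' + d) ^ k - (γ + c') ^ k - (b + d) ^ k
      + γ ^ k + b ^ k + c' ^ k + d ^ k) / q ^ 2) ^ r ≤
      exp (R * log ((1 - 2 * x + x * (t ^ k + s ^ k)) / q ^ 2)) := by
    calc _ ≤ ((1 - 2 * x + x * (t ^ k + s ^ k)) / q ^ 2) ^ r := by
            apply rpow_le_rpow (by positivity) _ hr.le
            exact div_le_div_of_nonneg_right hple (by positivity)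
      _ ≤ ((1 - 2 * x + x * (t ^ k + s ^ k)) / q ^ 2) ^ R := rpow_le_rpow_of_exponent_le hge hrR
      _ = _ := by rw [rpow_def_of_pos (by linarith), mul_comm]
  have hfin : R * log ((1 - 2 * x + x * (t ^ k + s ^ k)) / q ^ 2) +
      (negMulLog γ + negMulLog b + negMulLog c' + negMulLog d - log 4) < 0 := by
    by_cases hts' : t = s
    · have e1 : t = 1 / 2 := by linarith
      have e2 : s = 1 / 2 := by linarith
      have : (1 - 2 * x + x * (t ^ k + s ^ k)) / q ^ 2 = 1 := by
        rw [div_eq_one_iff_eq (by positivity), e1, e2, hq, ← two_mul, ← hx]; ring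
      rw [this, log_one, mul_zero, zero_add]
      have := aux_gibbs4 γ b c' d h1 hb0 hc0 hd0 hs hne'
      linarith
    · have hf := aux_f k x q R ε c t s hε k2 hx hq hc hx4 hR0.le hRx hts hs0 ht0 hts' hC1 hC2 hC3 hC4
      have g1 := aux_ent2 γ d h1 hd0
      have g2 := aux_ent2 b c' hb0 hc0
      rw [← ht] at g1
      rw [← hs'] at g2
      have e4 : log 4 = 2 * log 2 := by
        rw [show (4:ℝ) = 2 ^ 2 by norm_num, log_pow]; norm_num
      have e5 : t * log 2 + s * log 2 = log 2 := by rw [← add_mul, hts, one_mul]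
      linarith
  calc _ ≤ exp (R * log ((1 - 2 * x + x * (t ^ k + s ^ k)) / q ^ 2)) *
        exp (negMulLog γ + negMulLog b + negMulLog c' + negMulLog d - log 4) :=
        mul_le_mul_of_nonneg_right hpow (exp_pos _).le
    _ < 1 := by rw [← exp_add]; exact (exp_lt_exp.2 hfin).trans_eq exp_zero

noncomputable def auxP (k : ℕ) (y : Fin 3 → ℝ) : ℝ :=
  1 - (y 0 + y 1) ^ k - (1 - y 0 - y 1) ^ k - (y 0 + y 2) ^ k - (1 - y 0 - y 2) ^ k
    + y 0 ^ k + y 1 ^ k + y 2 ^ k + (1 - y 0 - y 1 - y 2) ^ k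

noncomputable def auxDP (k : ℕ) (y v : Fin 3 → ℝ) : ℝ :=
  k * (- (y 0 + y 1) ^ (k-1) * (v 0 + v 1) + (1 - y 0 - y 1) ^ (k-1) * (v 0 + v 1)
    - (y 0 + y 2) ^ (k-1) * (v 0 + v 2) + (1 - y 0 - y 2) ^ (k-1) * (v 0 + v 2)
    + y 0 ^ (k-1) * v 0 + y 1 ^ (k-1) * v 1 + y 2 ^ (k-1) * v 2
    - (1 - y 0 - y 1 - y 2) ^ (k-1) * (v 0 + v 1 + v 2))

noncomputable def auxD (k : ℕ) (r : ℝ) (y v : Fin 3 → ℝ) : ℝ :=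
  r * (auxDP k y v / auxP k y) - log (y 0) * v 0 - log (y 1) * v 1 - log (y 2) * v 2
    + log (1 - y 0 - y 1 - y 2) * (v 0 + v 1 + v 2)

noncomputable def auxG (k : ℕ) (r q : ℝ) (y : Fin 3 → ℝ) : ℝ :=
  exp (r * log (auxP k y / q ^ 2) + negMulLog (y 0) + negMulLog (y 1) + negMulLog (y 2)
    + negMulLog (1 - y 0 - y 1 - y 2) - log 4)

def auxU (k : ℕ) : Set (Fin 3 → ℝ) :=
  {y | 0 < y 0 ∧ 0 < y 1 ∧ 0 < y 2 ∧ 0 < 1 - y 0 - y 1 - y 2 ∧ 0 < auxP k y}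

theorem auxU_open (k : ℕ) : IsOpen (auxU k) := by
  have h0 : IsOpen {y : Fin 3 → ℝ | 0 < y 0} := isOpen_lt continuous_const (by fun_prop)
  have h1 : IsOpen {y : Fin 3 → ℝ | 0 < y 1} := isOpen_lt continuous_const (by fun_prop)
  have h2 : IsOpen {y : Fin 3 → ℝ | 0 < y 2} := isOpen_lt continuous_const (by fun_prop)
  have h3 : IsOpen {y : Fin 3 → ℝ | 0 < 1 - y 0 - y 1 - y 2} :=
    isOpen_lt continuous_const (by fun_prop)
  have h4 : IsOpen {y : Fin 3 → ℝ | 0 < auxP k y} :=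
    isOpen_lt continuous_const (by unfold auxP; fun_prop)
  exact h0.inter (h1.inter (h2.inter (h3.inter h4)))

theorem auxG_eq (k : ℕ) (r : ℝ) (hx : 2 * (1 / 2 : ℝ) ^ k ≤ 1 / 4) (y : Fin 3 → ℝ) (hy : y ∈ auxU k) :
    hypG k r (y 0 + y 1) (y 0 + y 2) (y 0) = auxG k r (1 - 2 * (1 / 2) ^ k) y := by
  obtain ⟨h0, h1, h2, h3, h4⟩ := hy
  rw [aux_hypG_eq k r _ _ _ h0.le (by linarith) (by linarith) (by linarith)]
  have e1 : y 0 + y 1 - y 0 = y 1 := by ring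
  have e2 : y 0 + y 2 - y 0 = y 2 := by ring
  have e3 : 1 - (y 0 + y 1) - (y 0 + y 2) + y 0 = 1 - y 0 - y 1 - y 2 := by ring
  have e4 : hypP k (y 0 + y 1) (y 0 + y 2) (y 0) = auxP k y := by
    unfold hypP auxP
    rw [e1, e2, e3, ← sub_sub, ← sub_sub]
  rw [e1, e2, e3, e4]
  have hq : (0:ℝ) < (1 - 2 * (1 / 2) ^ k) ^ 2 := by
    have : (0:ℝ) < 1 - 2 * (1 / 2) ^ k := by linarith
    positivity
  rw [rpow_def_of_pos (div_pos h4 hq), ← exp_add]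
  unfold auxG
  congr 1; ring

theorem auxP_line (k : ℕ) (y v : Fin 3 → ℝ) :
    HasDerivAt (fun τ : ℝ => auxP k (y + τ • v)) (auxDP k y v) 0 := by
  have h : ∀ i, HasDerivAt (fun τ : ℝ => (y + τ • v) i) (v i) 0 := by
    intro i
    simpa using ((hasDerivAt_id (0:ℝ)).mul_const (v i)).const_add (y i)
  have hd := (((hasDerivAt_const (0:ℝ) (1:ℝ)).sub (h 0)).sub (h 1)).sub (h 2)
  have := (((((((((hasDerivAt_const (0:ℝ) (1:ℝ)).sub (((h 0).add (h 1)).pow k)).sub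
    ((((hasDerivAt_const (0:ℝ) (1:ℝ)).sub (h 0)).sub (h 1)).pow k)).sub
    (((h 0).add (h 2)).pow k)).sub
    ((((hasDerivAt_const (0:ℝ) (1:ℝ)).sub (h 0)).sub (h 2)).pow k)).add ((h 0).pow k)).add
    ((h 1).pow k)).add ((h 2).pow k)).add (hd.pow k))
  refine this.congr_deriv ?_
  simp only [Pi.add_apply, Pi.sub_apply, Pi.smul_apply, Pi.zero_apply, smul_eq_mul, zero_mul,
    zero_smul, add_zero]
  unfold auxDP
  ring

theorem auxG_line (k : ℕ) (r q : ℝ) (hq : q ≠ 0) (y v : Fin 3 → ℝ) (hy : y ∈ auxU k) :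
    HasDerivAt (fun τ : ℝ => auxG k r q (y + τ • v)) (auxG k r q y * auxD k r y v) 0 := by
  obtain ⟨h0, h1, h2, h3, h4⟩ := hy
  have h : ∀ i, HasDerivAt (fun τ : ℝ => (y + τ • v) i) (v i) 0 := by
    intro i
    simpa using ((hasDerivAt_id (0:ℝ)).mul_const (v i)).const_add (y i)
  have z : y + (0:ℝ) • v = y := by simp
  have hd := (((hasDerivAt_const (0:ℝ) (1:ℝ)).sub (h 0)).sub (h 1)).sub (h 2)
  have n : ∀ (f : ℝ → ℝ) (f' : ℝ), HasDerivAt f f' 0 → f 0 ≠ 0 →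
      HasDerivAt (fun τ => negMulLog (f τ)) ((- log (f 0) - 1) * f') 0 := fun f f' hf h0 =>
    (hasDerivAt_negMulLog h0).comp 0 hf
  have hP := ((auxP_line k y v).div_const (q ^ 2)).log (by
    rw [z]; exact div_ne_zero h4.ne' (pow_ne_zero _ hq))
  have := ((((((hP.const_mul r).add (n _ _ (h 0) (by simpa using h0.ne'))).add
    (n _ _ (h 1) (by simpa using h1.ne'))).add (n _ _ (h 2) (by simpa using h2.ne'))).add
    (n _ _ hd (by simpa using h3.ne'))).sub_const (log 4)).exp
  refine this.congr_deriv ?_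
  simp only [Pi.add_apply, Pi.sub_apply, Pi.smul_apply, Pi.zero_apply, smul_eq_mul, zero_mul,
    zero_smul, add_zero]
  unfold auxG auxD
  congr 1
  field_simp
  ring

theorem auxG_diff (k : ℕ) (r q : ℝ) (hq : q ≠ 0) (y : Fin 3 → ℝ) (hy : y ∈ auxU k) :
    DifferentiableAt ℝ (auxG k r q) y := by
  obtain ⟨h0, h1, h2, h3, h4⟩ := hy
  have hP : DifferentiableAt ℝ (auxP k) y := by unfold auxP; fun_prop
  have hn : ∀ f : (Fin 3 → ℝ) → ℝ, DifferentiableAt ℝ f y → f y ≠ 0 →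
      DifferentiableAt ℝ (fun y => negMulLog (f y)) y := fun f hf h0 =>
    (hasDerivAt_negMulLog h0).differentiableAt.comp y hf
  unfold auxG
  refine DifferentiableAt.exp (DifferentiableAt.sub_const (((((?_ : DifferentiableAt ℝ _ y).add
    (hn (fun y => y 0) (by fun_prop) h0.ne')).add
    (hn (fun y => y 1) (by fun_prop) h1.ne')).add (hn (fun y => y 2) (by fun_prop) h2.ne')).add
    (hn (fun y => 1 - y 0 - y 1 - y 2) (by fun_prop) h3.ne')) _)
  have h5 : DifferentiableAt ℝ (fun y => auxP k y / q ^ 2) y := by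
    simp only [div_eq_mul_inv]; exact hP.mul_const _
  exact (h5.log (div_ne_zero h4.ne' (pow_ne_zero _ hq))).const_mul r

theorem auxD_diff (k : ℕ) (r : ℝ) (y v : Fin 3 → ℝ) (hy : y ∈ auxU k) :
    DifferentiableAt ℝ (fun y => auxD k r y v) y := by
  obtain ⟨h0, h1, h2, h3, h4⟩ := hy
  have hP : DifferentiableAt ℝ (auxP k) y := by unfold auxP; fun_prop
  have hDP : DifferentiableAt ℝ (fun y => auxDP k y v) y := by unfold auxDP; fun_prop
  have hl : ∀ f : (Fin 3 → ℝ) → ℝ, DifferentiableAt ℝ f y → f y ≠ 0 → ∀ C : ℝ,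
      DifferentiableAt ℝ (fun y => log (f y) * C) y := fun f hf h0 C => (hf.log h0).mul_const C
  have h5 : DifferentiableAt ℝ (fun y => auxDP k y v / auxP k y) y := by
    simp only [div_eq_mul_inv]; exact hDP.mul (hP.inv h4.ne')
  unfold auxD
  exact ((((h5.const_mul r).sub (hl (fun y => y 0) (by fun_prop) h0.ne' _)).sub
    (hl (fun y => y 1) (by fun_prop) h1.ne' _)).sub (hl (fun y => y 2) (by fun_prop) h2.ne' _)).add
    (hl (fun y => 1 - y 0 - y 1 - y 2) (by fun_prop) h3.ne' _)

theorem aux_fderiv_line (g : (Fin 3 → ℝ) → ℝ) (y v : Fin 3 → ℝ) (c : ℝ)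
    (hg : DifferentiableAt ℝ g y) (h : HasDerivAt (fun τ : ℝ => g (y + τ • v)) c 0) :
    fderiv ℝ g y v = c := by
  have h1 : HasLineDerivAt ℝ g (fderiv ℝ g y v) y v := hg.hasFDerivAt.hasLineDerivAt v
  exact HasDerivAt.unique h1 h

/-- value of the second derivative of log g at the center -/
noncomputable def auxH (k : ℕ) (r q : ℝ) (v w : Fin 3 → ℝ) : ℝ :=
  r * (k * (k - 1 : ℕ) * (- 2 * (1 / 2) ^ (k-1-1) * ((v 0 + v 1) * (w 0 + w 1) + (v 0 + v 2) * (w 0 + w 2))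
    + (1 / 4) ^ (k-1-1) * (v 0 * w 0 + v 1 * w 1 + v 2 * w 2 + (v 0 + v 1 + v 2) * (w 0 + w 1 + w 2)))
     / q ^ 2)
   - 4 * (v 0 * w 0 + v 1 * w 1 + v 2 * w 2 + (v 0 + v 1 + v 2) * (w 0 + w 1 + w 2))

theorem auxP_center (k : ℕ) : auxP k (fun _ => 1 / 4) = (1 - 2 * (1 / 2) ^ k) ^ 2 := by
  unfold auxP
  have : (1 / 4 : ℝ) ^ k = ((1 / 2) ^ k) ^ 2 := by rw [← pow_mul, mul_comm, pow_mul]; norm_num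
  norm_num at this ⊢
  rw [this]; ring

theorem auxDP_center (k : ℕ) (v : Fin 3 → ℝ) : auxDP k (fun _ => 1 / 4) v = 0 := by
  unfold auxDP; norm_num; right; ring

theorem auxD_center (k : ℕ) (r : ℝ) (v : Fin 3 → ℝ) : auxD k r (fun _ => 1 / 4) v = 0 := by
  unfold auxD; rw [auxDP_center]; norm_num; ring

theorem auxG_center (k : ℕ) (r : ℝ) (hx : 2 * (1 / 2 : ℝ) ^ k ≤ 1 / 4) :
    auxG k r (1 - 2 * (1 / 2) ^ k) (fun _ => 1 / 4) = 1 := by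
  unfold auxG
  have hq : (1 - 2 * (1 / 2 : ℝ) ^ k) ^ 2 ≠ 0 := by
    have : (0:ℝ) < 1 - 2 * (1 / 2) ^ k := by linarith
    positivity
  rw [auxP_center, div_self hq, log_one, exp_eq_one_iff]
  unfold negMulLog
  rw [show (1 - 1/4 - 1/4 - 1/4 : ℝ) = 1 / 4 by norm_num, one_div, log_inv]; ring

theorem aux_center_mem (k : ℕ) (hx : 2 * (1 / 2 : ℝ) ^ k ≤ 1 / 4) : (fun _ => 1 / 4) ∈ auxU k := by
  refine ⟨by norm_num, by norm_num, by norm_num, by norm_num, ?_⟩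
  rw [auxP_center]
  have : (0:ℝ) < 1 - 2 * (1 / 2) ^ k := by linarith
  positivity

theorem auxDP_line (k : ℕ) (v w : Fin 3 → ℝ) :
    HasDerivAt (fun τ : ℝ => auxDP k ((fun _ => 1 / 4) + τ • w) v)
      (k * (k - 1 : ℕ) * (- 2 * (1 / 2) ^ (k-1-1) * ((v 0 + v 1) * (w 0 + w 1) + (v 0 + v 2) * (w 0 + w 2))
    + (1 / 4) ^ (k-1-1) * (v 0 * w 0 + v 1 * w 1 + v 2 * w 2 + (v 0 + v 1 + v 2) * (w 0 + w 1 + w 2)))) 0 := by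
  have h : ∀ i, HasDerivAt (fun τ : ℝ => ((fun _ => 1 / 4 : Fin 3 → ℝ) + τ • w) i) (w i) 0 := by
    intro i
    simpa using ((hasDerivAt_id (0:ℝ)).mul_const (w i)).const_add (1 / 4)
  have hd := (((hasDerivAt_const (0:ℝ) (1:ℝ)).sub (h 0)).sub (h 1)).sub (h 2)
  have := ((((((((((h 0).add (h 1)).pow (k-1)).neg.mul_const (v 0 + v 1)).add
    (((((hasDerivAt_const (0:ℝ) (1:ℝ)).sub (h 0)).sub (h 1)).pow (k-1)).mul_const (v 0 + v 1))).sub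
    ((((h 0).add (h 2)).pow (k-1)).mul_const (v 0 + v 2))).add
    (((((hasDerivAt_const (0:ℝ) (1:ℝ)).sub (h 0)).sub (h 2)).pow (k-1)).mul_const (v 0 + v 2))).add
    (((h 0).pow (k-1)).mul_const (v 0))).add (((h 1).pow (k-1)).mul_const (v 1))).add
    (((h 2).pow (k-1)).mul_const (v 2))).sub ((hd.pow (k-1)).mul_const (v 0 + v 1 + v 2))
  refine (this.const_mul (k:ℝ)).congr_deriv ?_
  simp only [Pi.add_apply, Pi.sub_apply, Pi.smul_apply, Pi.zero_apply, smul_eq_mul, zero_mul,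
    zero_smul, add_zero]
  rw [show (1 - 1/4 - 1/4 - 1/4 : ℝ) = 1 / 4 by norm_num, show (1 - 1/4 - 1/4 : ℝ) = 1 / 2 by norm_num,
    show (1/4 + 1/4 : ℝ) = 1 / 2 by norm_num]
  ring

theorem auxD_line (k : ℕ) (r : ℝ) (hx : 2 * (1 / 2 : ℝ) ^ k ≤ 1 / 4) (v w : Fin 3 → ℝ) :
    HasDerivAt (fun τ : ℝ => auxD k r ((fun _ => 1 / 4) + τ • w) v)
      (auxH k r (1 - 2 * (1 / 2) ^ k) v w) 0 := by
  have h : ∀ i, HasDerivAt (fun τ : ℝ => ((fun _ => 1 / 4 : Fin 3 → ℝ) + τ • w) i) (w i) 0 := by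
    intro i
    simpa using ((hasDerivAt_id (0:ℝ)).mul_const (w i)).const_add (1 / 4)
  have z : (fun _ => 1 / 4 : Fin 3 → ℝ) + (0:ℝ) • w = fun _ => 1 / 4 := by simp
  have hq : (0:ℝ) < 1 - 2 * (1 / 2) ^ k := by linarith
  have hd := (((hasDerivAt_const (0:ℝ) (1:ℝ)).sub (h 0)).sub (h 1)).sub (h 2)
  have hdiv := (auxDP_line k v w).div (auxP_line k (fun _ => 1 / 4) w)
    (by rw [z, auxP_center]; positivity)
  have := ((((hdiv.const_mul r).sub (((h 0).log (by simp)).mul_const (v 0))).sub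
    (((h 1).log (by simp)).mul_const (v 1))).sub (((h 2).log (by simp)).mul_const (v 2))).add
    ((hd.log (by simp; norm_num)).mul_const (v 0 + v 1 + v 2))
  refine this.congr_deriv ?_
  simp only [Pi.add_apply, Pi.sub_apply, Pi.smul_apply, Pi.zero_apply, smul_eq_mul, zero_mul,
    zero_smul, add_zero, auxDP_center, auxP_center]
  unfold auxH
  rw [show (1 - 1/4 - 1/4 - 1/4 : ℝ) = 1 / 4 by norm_num]
  field_simp
  ring

theorem aux_hess (k : ℕ) (r : ℝ) (hx : 2 * (1 / 2 : ℝ) ^ k ≤ 1 / 4) (i j : Fin 3) :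
    hessEntry (fun ζ : Fin 3 → ℝ => hypG k r (ζ 0 + ζ 1) (ζ 0 + ζ 2) (ζ 0))
          (fun _ => 1 / 4) i j =
      auxH k r (1 - 2 * (1 / 2) ^ k) (Pi.single j 1) (Pi.single i 1) := by
  have hq : (0:ℝ) < 1 - 2 * (1 / 2) ^ k := by linarith
  set q : ℝ := 1 - 2 * (1 / 2) ^ k with hqd
  have hc := aux_center_mem k hx
  have hU := auxU_open k
  unfold hessEntry
  have e1 : (fun y => fderiv ℝ (fun ζ : Fin 3 → ℝ => hypG k r (ζ 0 + ζ 1) (ζ 0 + ζ 2) (ζ 0)) y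
      (Pi.single j 1)) =ᶠ[nhds (fun _ => 1 / 4)] fun y => auxG k r q y * auxD k r y (Pi.single j 1) := by
    filter_upwards [hU.mem_nhds hc] with y hy
    have : (fun ζ : Fin 3 → ℝ => hypG k r (ζ 0 + ζ 1) (ζ 0 + ζ 2) (ζ 0)) =ᶠ[nhds y] auxG k r q := by
      filter_upwards [hU.mem_nhds hy] with u hu
      exact auxG_eq k r hx u hu
    rw [this.fderiv_eq]
    exact aux_fderiv_line _ _ _ _ (auxG_diff k r q hq.ne' y hy) (auxG_line k r q hq.ne' y _ hy)
  rw [e1.fderiv_eq]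
  refine aux_fderiv_line _ _ _ _
    ((auxG_diff k r q hq.ne' _ hc).mul (auxD_diff k r _ _ hc)) ?_
  have := (auxG_line k r q hq.ne' _ (Pi.single i 1) hc).mul (auxD_line k r hx (Pi.single j 1) (Pi.single i 1))
  refine this.congr_deriv ?_
  have z : (fun _ => 1 / 4 : Fin 3 → ℝ) + (0:ℝ) • (Pi.single i 1 : Fin 3 → ℝ) = fun _ => 1 / 4 := by simp
  rw [z, auxD_center, auxG_center k r hx]; ring

theorem aux_det (k : ℕ) (r : ℝ) (hk2 : 2 ≤ k) (hx : 2 * (1 / 2 : ℝ) ^ k ≤ 1 / 4) (hr : 0 < r)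
    (hr2 : r ≤ 2 ^ k / 2) (hC : (k:ℝ) ^ 2 * (1 / 2) ^ k < 1 / 128) :
    Matrix.det (Matrix.of fun i j =>
        hessEntry (fun ζ : Fin 3 → ℝ => hypG k r (ζ 0 + ζ 1) (ζ 0 + ζ 2) (ζ 0))
          (fun _ => 1 / 4) i j) ≠ 0 := by
  simp only [aux_hess k r hx]
  have hq : (1 / 4:ℝ) ≤ (1 - 2 * (1 / 2) ^ k) ^ 2 := by
    have : (1/2:ℝ) ≤ 1 - 2 * (1 / 2) ^ k := by linarith
    nlinarith
  set q : ℝ := 1 - 2 * (1 / 2) ^ k with hqd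
  obtain ⟨m, rfl⟩ : ∃ m, k = m + 2 := ⟨k - 2, by omega⟩
  obtain ⟨l, hl⟩ : ∃ l : ℝ, l = 4 - r * ((m + 2) * (m + 1) * (1 / 4) ^ m / q ^ 2) := ⟨_, rfl⟩
  obtain ⟨μ, hμ⟩ : ∃ μ : ℝ, μ = r * ((m + 2) * (m + 1) * (2 * (1 / 2) ^ m) / q ^ 2) := ⟨_, rfl⟩
  have hμ0 : 0 ≤ μ := by rw [hμ]; positivity
  have hl0 : 0 < l := by
    rw [hl, sub_pos]
    have h4 : (1 / 4 : ℝ) ^ m = (1 / 2) ^ m * (1 / 2) ^ m := by rw [← mul_pow]; norm_num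
    have h2 : (2:ℝ) ^ m * (1 / 2) ^ m = 1 := by rw [← mul_pow]; norm_num
    have hp : (0:ℝ) < (1 / 2) ^ m := by positivity
    push_cast at hC
    rw [pow_add] at hC hr2
    rw [← mul_div_assoc, div_lt_iff₀ (by linarith), h4]
    have a1 : r * (1 / 2) ^ m ≤ 2 := by
      have := mul_le_mul_of_nonneg_right hr2 hp.le
      nlinarith
    have a2 : ((m:ℝ) + 2) * (m + 1) * (1 / 2) ^ m ≤ (m + 2) ^ 2 * (1 / 2) ^ m :=
      mul_le_mul_of_nonneg_right (by nlinarith [(Nat.cast_nonneg m : (0:ℝ) ≤ m)]) hp.le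
    have a3 : ((m:ℝ) + 2) * (m + 1) * (1 / 2) ^ m < 1 / 32 := by linarith
    have a4 : 0 ≤ ((m:ℝ) + 2) * (m + 1) * (1 / 2) ^ m := by positivity
    have := mul_le_mul_of_nonneg_right a1 a4
    linarith
  have hH : ∀ v w : Fin 3 → ℝ, auxH (m+2) r q v w =
      - l * (v 0 * w 0 + v 1 * w 1 + v 2 * w 2 + (v 0 + v 1 + v 2) * (w 0 + w 1 + w 2))
      - μ * ((v 0 + v 1) * (w 0 + w 1) + (v 0 + v 2) * (w 0 + w 2)) := by
    intro v w
    unfold auxH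
    rw [hl, hμ]
    rw [show m + 2 - 1 = m + 1 by omega, show m + 1 - 1 = m by omega]
    push_cast
    ring
  simp only [hH]
  rw [Matrix.det_fin_three]
  simp [Pi.single_apply]
  have : 0 < 4 * l * (l + μ) ^ 2 := by positivity
  intro h0
  apply this.ne'
  linear_combination -h0

/-- For every ε > 0 there is k₀(ε) such that for all k ≥ k₀ and all
0 < r ≤ 2^{k-1} ln 2 − (ln 2)/2 − (1+ε)/2: `g_r(1/2,1/2,1/4) = 1`, `g_r < 1` everywhere
else on the domain {0 ≤ γ ≤ min(α,β), α+β−γ ≤ 1}, and the Hessian determinant at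
(1/4,1/4,1/4) of (ζ₁,ζ₂,ζ₃) ↦ g_r(ζ₁+ζ₂, ζ₁+ζ₃, ζ₁) is nonzero. -/
theorem hypG_max :
    ∀ ε : ℝ, 0 < ε → ∃ k₀ : ℕ, ∀ k : ℕ, k₀ ≤ k → ∀ r : ℝ, 0 < r →
      r ≤ (2 : ℝ) ^ (k - 1) * Real.log 2 - Real.log 2 / 2 - (1 + ε) / 2 →
      hypG k r (1 / 2) (1 / 2) (1 / 4) = 1 ∧
      (∀ α β γ : ℝ, 0 ≤ γ → γ ≤ α → γ ≤ β → α + β - γ ≤ 1 →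
        (α, β, γ) ≠ (1 / 2, 1 / 2, 1 / 4) → hypG k r α β γ < 1) ∧
      Matrix.det (Matrix.of fun i j =>
        hessEntry (fun ζ : Fin 3 → ℝ => hypG k r (ζ 0 + ζ 1) (ζ 0 + ζ 2) (ζ 0))
          (fun _ => 1 / 4) i j) ≠ 0 := by
  intro ε hε
  obtain ⟨k₀, hk₀⟩ := aux_params ε hε
  refine ⟨k₀, fun k hk r hr hrR => ?_⟩
  have hp := hk₀ k hk
  refine ⟨?_, ?_, ?_⟩
  · have h := auxG_eq k r hp.2.1 _ (aux_center_mem k hp.2.1)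
    rw [auxG_center k r hp.2.1] at h
    rw [show (1 / 4 + 1 / 4 : ℝ) = 1 / 2 by norm_num] at h
    exact h
  · exact aux_lt_one k r ε hε hr hrR hp
  · refine aux_det k r hp.1 hp.2.1 hr ?_ hp.2.2.2.2.2.2
    have h1 := log_two_lt_d9
    have h2 : 0 < log 2 := log_pos (by norm_num)
    have h3 : (2:ℝ) ^ (k - 1) = 2 ^ k / 2 := by
      obtain ⟨m, rfl⟩ : ∃ m, k = m + 1 := ⟨k - 1, by have := hp.1; omega⟩
      rw [Nat.add_sub_cancel, pow_succ]; ring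
    rw [h3] at hrR
    have h4 : (0:ℝ) < 2 ^ k / 2 := by positivity
    nlinarith
end
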